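/- arXiv:1111.6807 — 4 statements merged into one kernel-verified Lean document; each statement's English description precedes it below -/
import Mathlib

section
/- For every constant C > 0 there exists a convex probability distribution μ on ℝ with finite differential entropy such that, for X and Y independent with distribution μ, min(H(X+Y), H(X−Y)) ≥ C·H(X), where H(W) = e^{2h(W)} is the entropy power. -/
open MeasureTheory Real Set

lemma integ_of_bdd {α : Type*} [MeasurableSpace α] {μ : Measure α} {F : α → ℝ} {S : Set α}
    (hS : μ S ≠ ⊤) (hF : Measurable F) (h0 : ∀ x, x ∉ S → F x = 0) (K : ℝ)
    (hK : ∀ x ∈ S, |F x| ≤ K) : Integrable F μ := by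
  have h1 : IntegrableOn F (toMeasurable μ S) μ := by
    refine Measure.integrableOn_of_bounded (M := max K 0) ?_ hF.aestronglyMeasurable ?_
    · rwa [measure_toMeasurable]
    · refine Filter.Eventually.of_forall fun x => ?_
      by_cases hx : x ∈ S
      · exact (hK x hx).trans (le_max_left _ _)
      · simp [h0 x hx]
  rw [integrableOn_iff_integrable_of_support_subset] at h1
  · exact h1
  · intro x hx
    by_contra h
    exact hx (h0 x fun h' => h (subset_toMeasurable μ S h'))

lemma log_key (u y s : ℝ) (hs : s = 1 ∨ s = -1) (hu : 1 ≤ u) (hy : 1 ≤ y) :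
    log u + log y - 2 * √(log y) * √(log u) ≤ log (|u + s * y| + 1) := by
  have hlu := log_nonneg hu
  have hly := log_nonneg hy
  have h1 : |u - y| ≤ |u + s * y| := by
    rcases hs with rfl | rfl
    · rw [one_mul, abs_of_nonneg (by linarith : 0 ≤ u + y), abs_le]
      constructor <;> linarith
    · simp [sub_eq_add_neg]
  have h2 : |log u - log y| ≤ log (|u - y| + 1) := by
    have hp : 0 < |u - y| + 1 := by positivity
    have e1 : log u ≤ log (|u - y| + 1) + log y := by
      rw [← log_mul hp.ne' (by linarith)]
      apply log_le_log (by linarith)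
      nlinarith [le_abs_self (u - y), abs_nonneg (u - y)]
    have e2 : log y ≤ log (|u - y| + 1) + log u := by
      rw [← log_mul hp.ne' (by linarith)]
      apply log_le_log (by linarith)
      nlinarith [neg_abs_le (u - y), abs_nonneg (u - y)]
    rw [abs_le]; constructor <;> linarith
  have h3 : log (|u - y| + 1) ≤ log (|u + s * y| + 1) :=
    log_le_log (by positivity) (by linarith)
  refine le_trans ?_ (h2.trans h3)
  have a1 := Real.sq_sqrt hlu
  have a2 := Real.sq_sqrt hly
  have b1 := Real.sqrt_nonneg (log u)
  have b2 := Real.sqrt_nonneg (log y)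
  set p := √(log u)
  set q := √(log y)
  rw [← a1, ← a2]
  rcases le_total p q with h | h
  · have := neg_abs_le (p ^ 2 - q ^ 2)
    nlinarith [mul_nonneg b1 (sub_nonneg.2 h)]
  · have := le_abs_self (p ^ 2 - q ^ 2)
    nlinarith [mul_nonneg b2 (sub_nonneg.2 h)]

lemma conv_entropy (f : ℝ → ℝ) (R s : ℝ) (hs : s = 1 ∨ s = -1) (hf : Measurable f)
    (h0 : ∀ x, 0 ≤ f x) (hsupp : ∀ x, x ∉ Icc 1 R → f x = 0)
    (hle : ∀ x ∈ Icc 1 R, f x ≤ 2 / x) (h1 : ∫ x, f x = 1) :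
    2 * (∫ x, f x * log x) - 2 * (∫ x, f x * √(log x)) ^ 2 - log 12 ≤
      -∫ x, (∫ y, f (x - s * y) * f y) * log (∫ y, f (x - s * y) * f y) := by
  have hle2 : ∀ x, f x ≤ 2 := by
    intro x
    by_cases hx : x ∈ Icc 1 R
    · refine (hle x hx).trans ?_
      rw [div_le_iff₀ (by linarith [hx.1])]
      linarith [hx.1]
    · simp [hsupp x hx]
  have hs0 : s ≠ 0 := by rcases hs with rfl | rfl <;> norm_num
  have hsa : |s| = 1 := by rcases hs with rfl | rfl <;> norm_num
  have hfi : Integrable f := by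
    by_contra h
    rw [integral_undef h] at h1
    norm_num at h1
  have hfs : ∀ x, Integrable (fun y => f (x - s * y)) := by
    intro x
    have := (hfi.comp_sub_left x).comp_mul_left' hs0
    exact this
  have hfs1 : ∀ x, ∫ y, f (x - s * y) = 1 := by
    intro x
    have := Measure.integral_comp_mul_left (fun z => f (x - z)) s
    rw [this, integral_sub_left_eq_self (fun z => f z) volume x, h1, abs_inv, hsa]
    simp
  have hmain : ∀ x y, f (x - s * y) * f y ≤ 6 / (|x| + 1) * (f (x - s * y) + f y) := by
    intro x y
    have hp : 0 < |x| + 1 := by positivity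
    by_cases ha : x - s * y ∈ Icc 1 R
    · by_cases hb : y ∈ Icc 1 R
      · have hx : |x| ≤ (x - s * y) + y := by
          calc |x| = |(x - s * y) + s * y| := by ring_nf
            _ ≤ |x - s * y| + |s * y| := abs_add_le _ _
            _ = _ := by
              rw [abs_mul, hsa, one_mul, abs_of_nonneg (by linarith [ha.1]),
                abs_of_nonneg (by linarith [hb.1])]
        have fa := hle _ ha
        have fb := hle _ hb
        have ga := h0 (x - s * y)
        have gb := h0 y
        have hc : 0 ≤ 6 / (|x| + 1) := by positivity
        have ha1 := ha.1
        have hb1 := hb.1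
        generalize x - s * y = a at *
        rcases le_total a y with h | h
        · have : f y ≤ 6 / (|x| + 1) := by
            refine fb.trans ?_
            rw [div_le_div_iff₀ (by linarith) hp]
            linarith
          nlinarith [mul_le_mul_of_nonneg_left this ga, mul_nonneg hc gb]
        · have : f a ≤ 6 / (|x| + 1) := by
            refine fa.trans ?_
            rw [div_le_div_iff₀ (by linarith) hp]
            linarith
          nlinarith [mul_le_mul_of_nonneg_right this gb, mul_nonneg hc ga]
      · rw [hsupp y hb]; simp; have := h0 (x - s * y); positivity
    · rw [hsupp _ ha]; simp; have := h0 y; positivity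
  set g : ℝ → ℝ := fun x => ∫ y, f (x - s * y) * f y with hg
  have hm2 : Measurable (fun p : ℝ × ℝ => f (p.1 - s * p.2) * f p.2) := by fun_prop
  have hgm : Measurable g := hm2.stronglyMeasurable.integral_prod_right'.measurable
  have hg0 : ∀ x, 0 ≤ g x := fun x => integral_nonneg fun y => mul_nonneg (h0 _) (h0 _)
  have hpi : ∀ x, Integrable (fun y => f (x - s * y) * f y) := by
    intro x
    refine integ_of_bdd (S := Icc 1 R) (by simp) (by fun_prop) ?_ 4 ?_
    · intro y hy; simp [hsupp y hy]
    · intro y _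
      rw [abs_of_nonneg (mul_nonneg (h0 _) (h0 _))]
      nlinarith [h0 (x - s * y), h0 y, hle2 (x - s * y), hle2 y]
  have hgle : ∀ x, g x ≤ 12 / (|x| + 1) := by
    intro x
    calc g x ≤ ∫ y, 6 / (|x| + 1) * (f (x - s * y) + f y) :=
          integral_mono (hpi x) (((hfs x).add hfi).const_mul _) (hmain x)
      _ = _ := by
        rw [integral_const_mul, integral_add (hfs x) hfi, hfs1, h1]; ring
  have hg12 : ∀ x, g x ≤ 12 := by
    intro x
    refine (hgle x).trans ?_
    rw [div_le_iff₀ (by positivity)]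
    nlinarith [abs_nonneg x]
  have hsup2 : ∀ x y, ¬ (x ∈ Icc (-(2*R)) (2*R) ∧ y ∈ Icc 1 R) → f (x - s * y) * f y = 0 := by
    intro x y h
    by_contra hne
    have hy : y ∈ Icc 1 R := by
      by_contra h'; simp [hsupp y h'] at hne
    have hx : x - s * y ∈ Icc 1 R := by
      by_contra h'; simp [hsupp _ h'] at hne
    apply h
    refine ⟨?_, hy⟩
    obtain ⟨a, b⟩ := hx
    obtain ⟨c, d⟩ := hy
    rcases hs with rfl | rfl <;> constructor <;> linarith
  have hgsupp : ∀ x, x ∉ Icc (-(2*R)) (2*R) → g x = 0 := by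
    intro x hx
    simp only [hg]
    rw [integral_eq_zero_of_ae]
    exact Filter.Eventually.of_forall fun y => hsup2 x y fun h => hx h.1
  obtain ⟨K, hK⟩ := (isCompact_Icc (a := (0:ℝ)) (b := 12)).exists_bound_of_continuousOn
    Real.continuous_mul_log.continuousOn
  have hgl : Integrable (fun x => g x * log (g x)) := by
    refine integ_of_bdd (S := Icc (-(2*R)) (2*R)) (by simp) (by fun_prop) ?_ K ?_
    · intro x hx; simp [hgsupp x hx]
    · intro x _; exact hK (g x) ⟨hg0 x, hg12 x⟩
  set W : ℝ → ℝ := fun x => log (|x| + 1) - log 12 with hW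
  have hWc : Continuous W := by
    refine Continuous.sub (Continuous.log (by fun_prop) ?_) continuous_const
    intro x; positivity
  have hWm : Measurable W := hWc.measurable
  obtain ⟨L, hL⟩ := (isCompact_Icc (a := -(2*R)) (b := 2*R)).exists_bound_of_continuousOn
    hWc.continuousOn
  have hgW : Integrable (fun x => g x * W x) := by
    refine integ_of_bdd (S := Icc (-(2*R)) (2*R)) (by simp) (by fun_prop) ?_ (12 * L) ?_
    · intro x hx; simp [hgsupp x hx]
    · intro x hx
      rw [abs_mul, abs_of_nonneg (hg0 x)]
      exact mul_le_mul (hg12 x) (hL x hx) (abs_nonneg _) (by norm_num)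
  have step1 : ∫ x, g x * W x ≤ -∫ x, g x * log (g x) := by
    rw [← integral_neg]
    refine integral_mono hgW hgl.neg fun x => ?_
    simp only
    rcases (hg0 x).eq_or_lt with h | h
    · simp [← h]
    · have : log (g x) ≤ - W x := by
        have := log_le_log h (hgle x)
        rw [log_div (by norm_num) (by positivity)] at this
        simp only [hW]; linarith
      nlinarith
  have hprod : Integrable (fun p : ℝ × ℝ => f (p.1 - s * p.2) * f p.2 * W p.1)
      (volume.prod volume) := by
    refine integ_of_bdd (S := Icc (-(2*R)) (2*R) ×ˢ Icc 1 R) ?_ (by fun_prop) ?_ (4 * L) ?_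
    · rw [Measure.prod_prod]
      exact ENNReal.mul_ne_top (by simp) (by simp)
    · intro p hp
      rw [hsup2 p.1 p.2 hp, zero_mul]
    · rintro ⟨x, y⟩ ⟨hx, hy⟩
      simp only
      rw [abs_mul, abs_of_nonneg (mul_nonneg (h0 _) (h0 _))]
      refine mul_le_mul ?_ (hL x hx) (abs_nonneg _) (by norm_num)
      nlinarith [h0 (x - s * y), h0 y, hle2 (x - s * y), hle2 y]
  have step2 : ∫ x, g x * W x = ∫ y, f y * ∫ u, f u * W (u + s * y) := by
    calc ∫ x, g x * W x = ∫ x, ∫ y, f (x - s * y) * f y * W x := by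
          refine integral_congr_ae (Filter.Eventually.of_forall fun x => ?_)
          simp only [hg]; rw [integral_mul_const]
      _ = ∫ y, ∫ x, f (x - s * y) * f y * W x := integral_integral_swap hprod
      _ = _ := by
          refine integral_congr_ae (Filter.Eventually.of_forall fun y => ?_)
          simp only
          rw [← integral_const_mul,
            ← integral_add_right_eq_self (fun x => f (x - s * y) * f y * W x) (s * y)]
          refine integral_congr_ae (Filter.Eventually.of_forall fun u => ?_)
          simp only [add_sub_cancel_right]; ring
  have hint2 : Integrable (fun y => f y * ∫ u, f u * W (u + s * y)) := by
    have := hprod.integral_prod_right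
    refine this.congr (Filter.Eventually.of_forall fun y => ?_)
    simp only
    rw [← integral_const_mul,
      ← integral_add_right_eq_self (fun x => f (x - s * y) * f y * W x) (s * y)]
    refine integral_congr_ae (Filter.Eventually.of_forall fun u => ?_)
    simp only [add_sub_cancel_right]; ring
  have hbd : ∀ x ∈ Icc 1 R, 0 ≤ log x ∧ log x ≤ log R := fun x hx =>
    ⟨log_nonneg hx.1, log_le_log (by linarith [hx.1]) hx.2⟩
  have hAi : Integrable (fun x => f x * log x) := by
    refine integ_of_bdd (S := Icc 1 R) (by simp) (by fun_prop) ?_ (2 * log R) ?_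
    · intro x hx; simp [hsupp x hx]
    · intro x hx
      rw [abs_mul, abs_of_nonneg (h0 x), abs_of_nonneg (hbd x hx).1]
      exact mul_le_mul (hle2 x) (hbd x hx).2 (hbd x hx).1 (by norm_num)
  have hBi : Integrable (fun x => f x * √(log x)) := by
    refine integ_of_bdd (S := Icc 1 R) (by simp) (by fun_prop) ?_ (2 * √(log R)) ?_
    · intro x hx; simp [hsupp x hx]
    · intro x hx
      rw [abs_mul, abs_of_nonneg (h0 x), abs_of_nonneg (sqrt_nonneg _)]
      exact mul_le_mul (hle2 x) (sqrt_le_sqrt (hbd x hx).2) (sqrt_nonneg _) (by norm_num)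
  set A := ∫ x, f x * log x with hA
  set B := ∫ x, f x * √(log x) with hB
  have hinner : ∀ y ∈ Icc 1 R, A + log y - 2 * √(log y) * B - log 12 ≤ ∫ u, f u * W (u + s * y) := by
    intro y hy
    have hi : Integrable (fun u => f u * W (u + s * y)) := by
      refine integ_of_bdd (S := Icc 1 R) (by simp) (by fun_prop) ?_ (2 * L) ?_
      · intro x hx; simp [hsupp x hx]
      · intro x hx
        rw [abs_mul, abs_of_nonneg (h0 x)]
        refine mul_le_mul (hle2 x) (hL _ ?_) (abs_nonneg _) (by norm_num)
        obtain ⟨a, b⟩ := hx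
        obtain ⟨c, d⟩ := hy
        rcases hs with rfl | rfl <;> constructor <;> linarith
    have heq : ∫ u, (f u * log u + f u * (log y - log 12) - 2 * √(log y) * (f u * √(log u)))
        = A + log y - 2 * √(log y) * B - log 12 := by
      have ha : Integrable (fun u => f u * log u + f u * (log y - log 12)) :=
        hAi.add (hfi.mul_const _)
      rw [integral_sub ha (hBi.const_mul _),
        integral_add hAi (hfi.mul_const _), integral_mul_const, integral_const_mul, h1]
      ring
    rw [← heq]
    refine integral_mono ((hAi.add (hfi.mul_const _)).sub (hBi.const_mul _)) hi fun u => ?_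
    simp only
    by_cases hu : u ∈ Icc 1 R
    · have := mul_le_mul_of_nonneg_left (log_key u y s hs hu.1 hy.1) (h0 u)
      simp only [hW]; linarith
    · simp [hsupp u hu]
  refine le_trans ?_ step1
  rw [step2]
  have heq : ∫ y, (f y * (A - log 12) + f y * log y - 2 * B * (f y * √(log y)))
        = 2 * A - 2 * B ^ 2 - log 12 := by
    have ha : Integrable (fun y => f y * (A - log 12) + f y * log y) :=
      (hfi.mul_const _).add hAi
    rw [integral_sub ha (hBi.const_mul _),
        integral_add (hfi.mul_const _) hAi, integral_mul_const, integral_const_mul, h1, ← hA, ← hB]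
    ring
  rw [← heq]
  refine integral_mono (((hfi.mul_const _).add hAi).sub (hBi.const_mul _)) hint2 fun y => ?_
  simp only
  by_cases hy : y ∈ Icc 1 R
  · have := mul_le_mul_of_nonneg_left (hinner y hy) (h0 y)
    linarith
  · simp [hsupp y hy]

lemma ftc_ind (a b : ℝ) (hab : a ≤ b) (k φ G : ℝ → ℝ)
    (hG : ∀ x ∈ Icc a b, HasDerivAt G (k x * φ x) x)
    (hc : ContinuousOn (fun x => k x * φ x) (Icc a b)) :
    ∫ x, (Icc a b).indicator k x * φ x = G b - G a := by
  have h1 : (fun x => (Icc a b).indicator k x * φ x) =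
      (Icc a b).indicator (fun x => k x * φ x) := by
    funext x
    by_cases hx : x ∈ Icc a b <;> simp [hx]
  rw [h1, integral_indicator measurableSet_Icc, integral_Icc_eq_integral_Ioc,
    ← intervalIntegral.integral_of_le hab]
  apply intervalIntegral.integral_eq_sub_of_hasDerivAt
  · rwa [uIcc_of_le hab]
  · apply ContinuousOn.intervalIntegrable
    rwa [uIcc_of_le hab]

lemma convex_aux (c R : ℝ) (hc : 0 < c) :
    ConvexOn ℝ (Icc (exp 1) R) (fun x => x * log x ^ 2 / c) := by
  have hpos : ∀ x ∈ Icc (exp 1) R, 0 < x := fun x hx => (exp_pos 1).trans_le hx.1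
  have hd : ∀ x, 0 < x → HasDerivAt (fun x => x * log x ^ 2 / c)
      ((log x ^ 2 + 2 * log x) / c) x := by
    intro x hx
    have := (((hasDerivAt_id x).mul ((hasDerivAt_log hx.ne').pow 2)).div_const c)
    refine HasDerivAt.congr_deriv this ?_
    simp
    field_simp
  apply MonotoneOn.convexOn_of_deriv (convex_Icc _ _)
  · intro x hx
    exact (hd x (hpos x hx)).continuousAt.continuousWithinAt
  · intro x hx
    exact (hd x (hpos x (interior_subset hx))).differentiableAt.differentiableWithinAt
  · intro x hx y hy hxy
    have hx' := interior_subset hx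
    have hy' := interior_subset hy
    rw [(hd x (hpos x hx')).deriv, (hd y (hpos y hy')).deriv]
    have h1 : 0 ≤ log x := log_nonneg ((one_le_exp (by norm_num)).trans hx'.1)
    have h2 : log x ≤ log y := log_le_log (hpos x hx') hxy
    gcongr

theorem stmt_9 :
    ∀ C > (0 : ℝ), ∃ (f V : ℝ → ℝ) (β : ℝ),
      1 ≤ β ∧
      (∀ x, 0 ≤ f x) ∧ (∫ x, f x = 1) ∧
      ConvexOn ℝ {x | 0 < f x} V ∧
      (∀ x, 0 < f x → 0 < V x ∧ f x = V x ^ (-β)) ∧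
      Integrable (fun x => f x * Real.log (f x)) ∧
      min (Real.exp (2 * (-∫ x, (∫ y, f (x - y) * f y) * Real.log (∫ y, f (x - y) * f y))))
          (Real.exp (2 * (-∫ x, (∫ y, f (x + y) * f y) * Real.log (∫ y, f (x + y) * f y))))
        ≥ C * Real.exp (2 * (-∫ x, f x * Real.log (f x))) := by
  intro C hC
  set M : ℝ := exp (60 + |log C|) with hM
  have hM2 : 2 ≤ M := by
    have := add_one_le_exp (60 + |log C|)
    have := abs_nonneg (log C)
    linarith
  set c : ℝ := M / (M - 1) with hcdef
  have hc1 : 1 ≤ c := by rw [hcdef, le_div_iff₀ (by linarith)]; linarith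
  have hc2 : c ≤ 2 := by rw [hcdef, div_le_iff₀ (by linarith)]; linarith
  set R := exp M with hR
  have heR : exp 1 ≤ R := exp_le_exp.2 (by linarith)
  have he1 : (1:ℝ) ≤ exp 1 := one_le_exp (by norm_num)
  set k : ℝ → ℝ := fun x => c / (x * log x ^ 2) with hk
  set f : ℝ → ℝ := (Icc (exp 1) R).indicator k with hf
  have hpos : ∀ x ∈ Icc (exp 1) R, 0 < x := fun x hx => (exp_pos 1).trans_le hx.1
  have hlog : ∀ x ∈ Icc (exp 1) R, 1 ≤ log x := fun x hx => by
    rw [le_log_iff_exp_le (hpos x hx)]; exact hx.1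
  have hkpos : ∀ x ∈ Icc (exp 1) R, 0 < k x := fun x hx => by
    have := hpos x hx
    have := hlog x hx
    simp only [hk]; positivity
  have hfin : ∀ x ∈ Icc (exp 1) R, f x = k x := fun x hx => indicator_of_mem hx _
  have hfout : ∀ x, x ∉ Icc (exp 1) R → f x = 0 := fun x hx => indicator_of_notMem hx _
  have hf0 : ∀ x, 0 ≤ f x := fun x => by
    by_cases hx : x ∈ Icc (exp 1) R
    · rw [hfin x hx]; exact (hkpos x hx).le
    · rw [hfout x hx]
  have hfpos : ∀ x, 0 < f x ↔ x ∈ Icc (exp 1) R := fun x => by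
    constructor
    · intro h
      by_contra hx
      rw [hfout x hx] at h
      exact h.ne rfl
    · intro hx; rw [hfin x hx]; exact hkpos x hx
  have hkm : Measurable k := by simp only [hk]; fun_prop
  have hfm : Measurable f := hkm.indicator measurableSet_Icc
  have hlc : ContinuousOn log (Icc (exp 1) R) := fun x hx =>
    (continuousAt_log (hpos x hx).ne').continuousWithinAt
  have hkc : ContinuousOn k (Icc (exp 1) R) := by
    refine ContinuousOn.div continuousOn_const (continuousOn_id.mul (hlc.pow 2)) ?_
    intro x hx
    have := hpos x hx
    have := hlog x hx
    change x * log x ^ 2 ≠ 0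
    positivity
  have hI : ∫ x, f x = 1 := by
    have := ftc_ind (exp 1) R heR k (fun _ => 1) (fun x => -c / log x) ?_ ?_
    · simp only [mul_one] at this
      rw [this, hR, log_exp, log_exp, hcdef]
      have : M - 1 ≠ 0 := by linarith
      have : M ≠ 0 := by linarith
      field_simp
      ring
    · intro x hx
      have h1 := hpos x hx
      have h2 := hlog x hx
      have := (hasDerivAt_const x (-c)).div (hasDerivAt_log h1.ne') (by positivity)
      refine this.congr_deriv ?_
      simp only [hk]
      field_simp
      ring
    · simpa using hkc
  have hA : ∫ x, f x * log x = c * log M := by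
    have := ftc_ind (exp 1) R heR k log (fun x => c * log (log x)) ?_ (hkc.mul hlc)
    · rw [this, hR, log_exp, log_exp]; simp
    · intro x hx
      have h1 := hpos x hx
      have h2 := hlog x hx
      have := ((hasDerivAt_log h1.ne').log (by positivity)).const_mul c
      refine this.congr_deriv ?_
      simp only [hk]
      field_simp
  have hB : ∫ x, f x * √(log x) = c * (2 - 2 / √M) := by
    have := ftc_ind (exp 1) R heR k (fun x => √(log x)) (fun x => -(2 * c) / √(log x)) ?_
      (hkc.mul hlc.sqrt)
    · rw [this, hR, log_exp, log_exp]; simp; ring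
    · intro x hx
      have h1 := hpos x hx
      have h2 := hlog x hx
      have h3 : 0 < log x := by linarith
      have h4 : 0 < √(log x) := sqrt_pos.2 h3
      have := (hasDerivAt_const x (-(2 * c))).div ((hasDerivAt_log h1.ne').sqrt h3.ne') h4.ne'
      refine this.congr_deriv ?_
      simp only [hk]
      have h5 := Real.sq_sqrt h3.le
      rw [h5]
      field_simp
      rw [h5]
      ring
  have hBb : |∫ x, f x * √(log x)| ≤ 4 := by
    have h1 : 1 ≤ √M := by rw [Real.one_le_sqrt]; linarith
    have h2 : 0 ≤ 2 / √M := by positivity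
    have h3 : 2 / √M ≤ 2 := by rw [div_le_iff₀ (by linarith)]; linarith
    rw [hB, abs_le]
    constructor <;> nlinarith
  have hsupp1 : ∀ x, x ∉ Icc 1 R → f x = 0 := fun x hx =>
    hfout x fun h => hx ⟨he1.trans h.1, h.2⟩
  have hle : ∀ x ∈ Icc 1 R, f x ≤ 2 / x := by
    intro x hx1
    have hx0 : 0 < x := by linarith [hx1.1]
    by_cases hx : x ∈ Icc (exp 1) R
    · rw [hfin x hx]
      have h2 := hlog x hx
      simp only [hk]
      rw [div_le_div_iff₀ (by positivity) hx0]
      have : 1 ≤ log x ^ 2 := by nlinarith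
      nlinarith
    · rw [hfout x hx]; positivity
  have hcore := fun s hs => conv_entropy f R s hs hfm hf0 hsupp1 hle hI
  have hkb : ∀ g : ℝ → ℝ, ContinuousOn g (Icc (exp 1) R) → Measurable g →
      Integrable (fun x => f x * g x) := by
    intro g hg hgm
    obtain ⟨K, hK⟩ := (isCompact_Icc (a := exp 1) (b := R)).exists_bound_of_continuousOn
      (hkc.mul hg)
    refine integ_of_bdd (S := Icc (exp 1) R) (by simp) (by fun_prop) ?_ K ?_
    · intro x hx; simp [hfout x hx]
    · intro x hx
      rw [hfin x hx]; exact hK x hx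
  have hent : Integrable (fun x => f x * log (f x)) := by
    have := hkb (fun x => log (k x)) (hkc.log fun x hx => (hkpos x hx).ne') (by fun_prop)
    refine this.congr (Filter.Eventually.of_forall fun x => ?_)
    simp only
    by_cases hx : x ∈ Icc (exp 1) R
    · rw [hfin x hx]
    · simp [hfout x hx]
  have hAi := hkb log hlc measurable_log
  have hBi := hkb (fun x => √(log x)) hlc.sqrt (by fun_prop)
  have hX : -∫ x, f x * log (f x) ≤ (∫ x, f x * log x) + 4 * ∫ x, f x * √(log x) := by
    rw [← integral_neg, ← integral_const_mul, ← integral_add hAi (hBi.const_mul _)]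
    refine integral_mono hent.neg (hAi.add (hBi.const_mul _)) fun x => ?_
    simp only
    by_cases hx : x ∈ Icc (exp 1) R
    · have h1 := hpos x hx
      have h2 := hlog x hx
      have h3 : 0 < log x := by linarith
      have h4 : 0 < √(log x) := sqrt_pos.2 h3
      have h5 : log (k x) = log c - (log x + 2 * log (log x)) := by
        simp only [hk]
        rw [log_div (by positivity) (by positivity), log_mul (by positivity) (by positivity),
          log_pow]
        push_cast; ring
      have h6 : 0 ≤ log c := log_nonneg hc1
      have h7 : log (log x) ≤ 2 * √(log x) := by
        have := log_sqrt h3.le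
        have := log_le_sub_one_of_pos h4
        linarith
      have h8 : - log (f x) ≤ log x + 4 * √(log x) := by
        rw [hfin x hx, h5]; linarith
      nlinarith [mul_le_mul_of_nonneg_left h8 (hf0 x)]
    · simp [hfout x hx]
  have hl12 : log 12 ≤ 11 := by
    have := log_le_sub_one_of_pos (show (0:ℝ) < 12 by norm_num)
    linarith
  have hlogM : log M = 60 + |log C| := by rw [hM, log_exp]
  have hAb : 60 + |log C| ≤ ∫ x, f x * log x := by
    rw [hA, hlogM]
    nlinarith [abs_nonneg (log C)]
  have hfinal : ∀ h : ℝ, 2 * (∫ x, f x * log x) - 2 * (∫ x, f x * √(log x)) ^ 2 - log 12 ≤ h →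
      C * exp (2 * (-∫ x, f x * log (f x))) ≤ exp (2 * h) := by
    intro h hh
    nth_rewrite 1 [← exp_log hC]
    rw [← exp_add, exp_le_exp]
    have h1 := abs_le.1 hBb
    have h2 : (∫ x, f x * √(log x)) ^ 2 ≤ 16 := by nlinarith [h1.1, h1.2]
    have := le_abs_self (log C)
    have := abs_nonneg (log C)
    linarith [h1.1, h1.2]
  refine ⟨f, fun x => x * log x ^ 2 / c, 1, le_rfl, hf0, hI, ?_, ?_, hent, ?_⟩
  · have : {x | 0 < f x} = Icc (exp 1) R := by ext x; exact hfpos x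
    rw [this]
    exact convex_aux c R (by linarith)
  · intro x hx
    rw [hfpos] at hx
    have h1 := hpos x hx
    have h2 := hlog x hx
    refine ⟨by positivity, ?_⟩
    rw [hfin x hx, rpow_neg_one]
    simp only [hk, inv_div]
  · refine le_min (hfinal _ ?_) (hfinal _ ?_)
    · simpa using hcore 1 (Or.inl rfl)
    · simpa using hcore (-1) (Or.inr rfl)
end

section
/- Let X, Y, Z be independent random vectors in ℝⁿ with absolutely continuous distributions and well-defined finite differential entropies. Then h(X+Y+Z) + h(Z) ≤ h(X+Z) + h(Y+Z). -/
open MeasureTheory Real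
open scoped ENNReal

lemma aux_lconv_one {n : ℕ} {F G : (Fin n → ℝ) → ℝ≥0∞} (hF : Measurable F) (hG : Measurable G)
    (hF1 : ∫⁻ x, F x = 1) (hG1 : ∫⁻ x, G x = 1) : ∫⁻ x, (G ⋆ₗ F) x = 1 := by
  simp only [lconvolution_def]
  rw [lintegral_lintegral_swap (by fun_prop)]
  have : ∀ y, ∫⁻ x, G y * F (-y + x) = G y := by
    intro y
    rw [lintegral_const_mul _ (by fun_prop), lintegral_add_left_eq_self F (-y), hF1, mul_one]
  simp [this, hG1]

/-- Bochner convolution agrees with the `ℝ≥0∞`-valued convolution. -/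
lemma aux_bridge {n : ℕ} {f g : (Fin n → ℝ) → ℝ} {F G : (Fin n → ℝ) → ℝ≥0∞}
    (hf : ∀ x, 0 ≤ f x) (hg : ∀ x, 0 ≤ g x) (hF : Measurable F) (hG : Measurable G)
    (hfF : (fun x => ENNReal.ofReal (f x)) =ᵐ[volume] F)
    (hgG : (fun x => ENNReal.ofReal (g x)) =ᵐ[volume] G) (x : Fin n → ℝ) :
    ∫ y, f (x - y) * g y = ((G ⋆ₗ F) x).toReal := by
  have e : (fun y => ENNReal.ofReal (f (x - y) * g y)) =ᵐ[volume] fun y => G y * F (-y + x) := by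
    have h := (quasiMeasurePreserving_sub_left volume x).ae hfF
    filter_upwards [h, hgG] with y h1 h2
    rw [ENNReal.ofReal_mul (hf _), h1, h2, mul_comm, sub_eq_neg_add]
  have m : AEMeasurable (fun y => f (x - y) * g y) volume := by
    have : AEMeasurable (fun y => (ENNReal.ofReal (f (x - y) * g y)).toReal) volume :=
      (AEMeasurable.congr (by fun_prop) e.symm).ennreal_toReal
    refine this.congr (Filter.Eventually.of_forall fun y => ?_)
    exact ENNReal.toReal_ofReal (mul_nonneg (hf _) (hg _))
  rw [integral_eq_lintegral_of_nonneg_ae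
    (Filter.Eventually.of_forall fun y => mul_nonneg (hf _) (hg _)) m.aestronglyMeasurable,
    lintegral_congr_ae e, lconvolution_def]

lemma aux_ofReal {n : ℕ} {f : (Fin n → ℝ) → ℝ} {F : (Fin n → ℝ) → ℝ≥0∞} (hF : Measurable F)
    (hF1 : ∫⁻ x, F x = 1) (h : ∀ x, f x = (F x).toReal) :
    (fun x => ENNReal.ofReal (f x)) =ᵐ[volume] F := by
  filter_upwards [ae_lt_top hF (by simp [hF1])] with x hx
  rw [h, ENNReal.ofReal_toReal hx.ne]

lemma aux_dens {n : ℕ} {f : (Fin n → ℝ) → ℝ} (hf : ∀ x, 0 ≤ f x) (h1 : ∫ x, f x = 1) :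
    ∃ F : (Fin n → ℝ) → ℝ≥0∞, Measurable F ∧ ∫⁻ x, F x = 1 ∧
      (fun x => ENNReal.ofReal (f x)) =ᵐ[volume] F := by
  have hi : Integrable f := by
    by_contra h
    rw [integral_undef h] at h1
    norm_num at h1
  have hm : AEMeasurable (fun x => ENNReal.ofReal (f x)) volume := hi.aemeasurable.ennreal_ofReal
  refine ⟨hm.mk _, hm.measurable_mk, ?_, hm.ae_eq_mk⟩
  rw [← lintegral_congr_ae hm.ae_eq_mk,
    ← ofReal_integral_eq_lintegral_ofReal hi (Filter.Eventually.of_forall hf), h1]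
  simp

/-- entropy integrals through a law -/
lemma aux_law {n : ℕ} {Ω : Type*} [MeasurableSpace Ω] (μ : Measure Ω) {T : Ω → (Fin n → ℝ)}
    (hT : Measurable T) {F : (Fin n → ℝ) → ℝ≥0∞} (hF : Measurable F) (hF1 : ∫⁻ x, F x = 1)
    (hmap : μ.map T = volume.withDensity F)
    (hint : Integrable fun x => (F x).toReal * Real.log (F x).toReal) :
    (∀ᵐ ω ∂μ, F (T ω) ≠ 0 ∧ F (T ω) ≠ ⊤) ∧
    Integrable (fun ω => Real.log (F (T ω)).toReal) μ ∧
    ∫ ω, Real.log (F (T ω)).toReal ∂μ = ∫ x, (F x).toReal * Real.log (F x).toReal := by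
  have hlt : ∀ᵐ x, F x < ⊤ := ae_lt_top hF (by simp [hF1])
  have hsm : AEStronglyMeasurable (fun x => Real.log (F x).toReal) (μ.map T) := by
    have : Measurable (fun x => Real.log (F x).toReal) := by fun_prop
    exact this.aestronglyMeasurable
  refine ⟨?_, ?_, ?_⟩
  · have : ∀ᵐ x ∂(μ.map T), F x ≠ 0 ∧ F x ≠ ⊤ := by
      rw [hmap, ae_withDensity_iff hF]
      filter_upwards [hlt] with x hx h0 using ⟨h0, hx.ne⟩
    exact ae_of_ae_map hT.aemeasurable this
  · have := (integrable_map_measure hsm hT.aemeasurable).1 (by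
      rw [hmap, integrable_withDensity_iff_integrable_smul' hF hlt]
      simpa using hint)
    exact this
  · rw [← integral_map hT.aemeasurable hsm, hmap,
      integral_withDensity_eq_integral_toReal_smul hF hlt]
    simp

lemma aux_core {n : ℕ} {a b c : (Fin n → ℝ) → ℝ≥0∞} (ha : Measurable a) (hb : Measurable b)
    (hc : Measurable c) (ha1 : ∫⁻ x, a x = 1) (hb1 : ∫⁻ x, b x = 1) (hc1 : ∫⁻ x, c x = 1)
    {A B D : (Fin n → ℝ) → ℝ≥0∞} (hA : A = a ⋆ₗ c) (hB : B = b ⋆ₗ c) (hD : D = a ⋆ₗ B)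
    (iA : Integrable fun x => (A x).toReal * Real.log (A x).toReal)
    (iB : Integrable fun x => (B x).toReal * Real.log (B x).toReal)
    (iC : Integrable fun x => (c x).toReal * Real.log (c x).toReal)
    (iD : Integrable fun x => (D x).toReal * Real.log (D x).toReal) :
    (∫ x, (A x).toReal * Real.log (A x).toReal) + (∫ x, (B x).toReal * Real.log (B x).toReal)
    ≤ (∫ x, (D x).toReal * Real.log (D x).toReal) + ∫ x, (c x).toReal * Real.log (c x).toReal := by
  have mA : Measurable A := hA ▸ measurable_lconvolution volume ha hc
  have mB : Measurable B := hB ▸ measurable_lconvolution volume hb hc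
  have mD : Measurable D := hD ▸ measurable_lconvolution volume ha mB
  have A1 : ∫⁻ x, A x = 1 := hA ▸ aux_lconv_one hc ha hc1 ha1
  have B1 : ∫⁻ x, B x = 1 := hB ▸ aux_lconv_one hc hb hc1 hb1
  have D1 : ∫⁻ x, D x = 1 := hD ▸ aux_lconv_one mB ha B1 ha1
  have hD' : D = b ⋆ₗ A := by
    rw [hD, hA, hB, lconvolution_assoc ha hb hc, lconvolution_comm (f := a) (g := b),
      ← lconvolution_assoc hb ha hc]
  have pr : ∀ f : (Fin n → ℝ) → ℝ≥0∞, ∫⁻ x, f x = 1 →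
      IsProbabilityMeasure (volume.withDensity f) := fun f h => ⟨by simp [h]⟩
  set P := (volume : Measure (Fin n → ℝ)).withDensity a with hP
  set Q := (volume : Measure (Fin n → ℝ)).withDensity b with hQ
  set R := (volume : Measure (Fin n → ℝ)).withDensity c with hR
  have : IsProbabilityMeasure P := pr a ha1
  have : IsProbabilityMeasure Q := pr b hb1
  have : IsProbabilityMeasure R := pr c hc1
  set μ := P.prod (Q.prod R) with hμ
  have lC : μ.map (fun w => w.2.2) = volume.withDensity c := by
    have : (fun w : (Fin n → ℝ) × (Fin n → ℝ) × (Fin n → ℝ) => w.2.2) = Prod.snd ∘ Prod.snd := rfl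
    rw [this, ← Measure.map_map measurable_snd measurable_snd]
    simp [hμ, hR]
  have lB : μ.map (fun w => w.2.1 + w.2.2) = volume.withDensity B := by
    have : (fun w : (Fin n → ℝ) × (Fin n → ℝ) × (Fin n → ℝ) => w.2.1 + w.2.2)
      = (fun v : (Fin n → ℝ) × (Fin n → ℝ) => v.1 + v.2) ∘ Prod.snd := rfl
    rw [this, ← Measure.map_map (by fun_prop) measurable_snd, hB,
      ← conv_withDensity_eq_lconvolution hb hc]
    simp [hμ, hQ, hR, Measure.conv]
  have lA : μ.map (fun w => w.1 + w.2.2) = volume.withDensity A := by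
    have : (fun w : (Fin n → ℝ) × (Fin n → ℝ) × (Fin n → ℝ) => w.1 + w.2.2)
      = (fun v : (Fin n → ℝ) × (Fin n → ℝ) => v.1 + v.2) ∘ (Prod.map id Prod.snd) := rfl
    rw [this, ← Measure.map_map (by fun_prop) (by fun_prop), hA,
      ← conv_withDensity_eq_lconvolution ha hc, hμ,
      ← Measure.map_prod_map _ _ measurable_id measurable_snd]
    simp [Measure.conv, hP, hR]
  have lD : μ.map (fun w => w.1 + (w.2.1 + w.2.2)) = volume.withDensity D := by
    have : (fun w : (Fin n → ℝ) × (Fin n → ℝ) × (Fin n → ℝ) => w.1 + (w.2.1 + w.2.2))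
      = (fun v : (Fin n → ℝ) × (Fin n → ℝ) => v.1 + v.2) ∘
        (Prod.map id (fun v : (Fin n → ℝ) × (Fin n → ℝ) => v.1 + v.2)) := rfl
    rw [this, ← Measure.map_map (by fun_prop) (by fun_prop), hD,
      ← conv_withDensity_eq_lconvolution ha mB, hμ,
      ← Measure.map_prod_map _ _ measurable_id (by fun_prop), hB,
      ← conv_withDensity_eq_lconvolution hb hc]
    simp [Measure.conv, hP, hQ, hR]
  obtain ⟨nA, jA, eA⟩ := aux_law μ (by fun_prop) mA A1 lA iA
  obtain ⟨nB, jB, eB⟩ := aux_law μ (by fun_prop) mB B1 lB iB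
  obtain ⟨nC, jC, eC⟩ := aux_law μ (by fun_prop) hc hc1 lC iC
  obtain ⟨nD, jD, eD⟩ := aux_law μ (by fun_prop) mD D1 lD iD
  have jAB : Integrable (fun w : (Fin n → ℝ) × (Fin n → ℝ) × (Fin n → ℝ) =>
      Real.log (A (w.1 + w.2.2)).toReal + Real.log (B (w.2.1 + w.2.2)).toReal) μ := jA.add jB
  have jDC : Integrable (fun w : (Fin n → ℝ) × (Fin n → ℝ) × (Fin n → ℝ) =>
      Real.log (D (w.1 + (w.2.1 + w.2.2))).toReal + Real.log (c w.2.2).toReal) μ := jD.add jC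
  rw [← eA, ← eB, ← eC, ← eD, ← sub_nonpos, ← integral_add jA jB, ← integral_add jD jC,
    ← integral_sub jAB jDC]
  let t : (Fin n → ℝ) × (Fin n → ℝ) × (Fin n → ℝ) → ℝ≥0∞ := fun w =>
    (c w.2.2)⁻¹ * (A (w.1 + w.2.2) * B (w.2.1 + w.2.2) * (D (w.1 + (w.2.1 + w.2.2)))⁻¹)
  have mt : Measurable t := by fun_prop
  have ht : ∫⁻ w, t w ∂μ ≤ 1 := by
    calc ∫⁻ w, t w ∂μ = ∫⁻ x, a x * ∫⁻ y, b y * ∫⁻ z, c z * t (x, y, z) := by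
          rw [hμ, lintegral_prod _ mt.aemeasurable, hP,
            lintegral_withDensity_eq_lintegral_mul _ ha (by fun_prop)]
          refine lintegral_congr fun x => ?_
          rw [Pi.mul_apply, lintegral_prod _ (by fun_prop), hQ,
            lintegral_withDensity_eq_lintegral_mul _ hb (by fun_prop)]
          congr 1
          refine lintegral_congr fun y => ?_
          rw [Pi.mul_apply, hR,
            lintegral_withDensity_eq_lintegral_mul _ hc (by fun_prop)]
          rfl
      _ ≤ ∫⁻ x, a x * ∫⁻ y, b y * ∫⁻ z,
            A (x + z) * B (y + z) * (D (x + (y + z)))⁻¹ := by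
          refine lintegral_mono fun x => mul_le_mul_right (lintegral_mono fun y =>
            mul_le_mul_right (lintegral_mono fun z => ?_) _) _
          change c z * ((c z)⁻¹ * (A (x + z) * B (y + z) * (D (x + (y + z)))⁻¹)) ≤ _
          rw [← mul_assoc]
          exact mul_le_of_le_one_left' (ENNReal.mul_inv_le_one _)
      _ = ∫⁻ x, a x * ∫⁻ y, b y * ∫⁻ w, A (-y + w) * B (-x + w) * (D w)⁻¹ := by
          refine lintegral_congr fun x => ?_
          congr 1
          refine lintegral_congr fun y => ?_
          congr 1
          rw [← lintegral_add_left_eq_self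
            (fun w => A (-y + w) * B (-x + w) * (D w)⁻¹) (x + y)]
          refine lintegral_congr fun z => ?_
          have z1 : -y + (x + y + z) = x + z := by abel
          have z2 : -x + (x + y + z) = y + z := by abel
          rw [z1, z2, add_assoc x y z]
      _ = ∫⁻ x, ∫⁻ y, ∫⁻ w, a x * (b y * (A (-y + w) * B (-x + w) * (D w)⁻¹)) := by
          refine lintegral_congr fun x => ?_
          rw [← lintegral_const_mul _ (by fun_prop)]
          refine lintegral_congr fun y => ?_
          rw [← lintegral_const_mul _ (by fun_prop), ← lintegral_const_mul _ (by fun_prop)]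
      _ = ∫⁻ x, ∫⁻ w, ∫⁻ y, a x * (b y * (A (-y + w) * B (-x + w) * (D w)⁻¹)) := by
          refine lintegral_congr fun x => ?_
          rw [lintegral_lintegral_swap (by fun_prop)]
      _ = ∫⁻ w, ∫⁻ x, ∫⁻ y, a x * (b y * (A (-y + w) * B (-x + w) * (D w)⁻¹)) := by
          rw [lintegral_lintegral_swap (by fun_prop)]
      _ = ∫⁻ w, D w * D w * (D w)⁻¹ := by
          refine lintegral_congr fun w => ?_
          have e1 : ∫⁻ y, b y * A (-y + w) = D w := by rw [hD']; rfl
          have e2 : ∫⁻ x, a x * B (-x + w) = D w := by rw [hD]; rfl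
          have : ∀ x, ∫⁻ y, a x * (b y * (A (-y + w) * B (-x + w) * (D w)⁻¹))
              = (a x * B (-x + w)) * (D w * (D w)⁻¹) := by
            intro x
            nth_rw 2 [← e1]
            rw [← lintegral_mul_const _ (by fun_prop), ← lintegral_const_mul _ (by fun_prop)]
            refine lintegral_congr fun y => ?_
            ring
          simp_rw [this]
          rw [lintegral_mul_const _ (by fun_prop), e2, mul_assoc]
      _ ≤ ∫⁻ w, D w := by
          gcongr with w
          rw [mul_assoc]
          exact mul_le_of_le_one_right' (ENNReal.mul_inv_le_one _)
      _ = 1 := D1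
  have it : Integrable (fun w => (t w).toReal) μ :=
    integrable_toReal_of_lintegral_ne_top mt.aemeasurable (ht.trans_lt ENNReal.one_lt_top).ne
  have htReal : ∫ w, (t w).toReal ∂μ ≤ 1 := by
    rw [integral_toReal mt.aemeasurable
      (ae_lt_top mt (ht.trans_lt ENNReal.one_lt_top).ne)]
    exact ENNReal.toReal_le_of_le_ofReal zero_le_one (by simpa using ht)
  refine (integral_mono_ae (g := fun w => (t w).toReal - 1) (jAB.sub jDC)
    (it.sub (integrable_const 1)) ?_).trans ?_
  · filter_upwards [nA, nB, nC, nD] with w wA wB wC wD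
    have qA := ENNReal.toReal_pos wA.1 wA.2
    have qB := ENNReal.toReal_pos wB.1 wB.2
    have qC := ENNReal.toReal_pos wC.1 wC.2
    have qD := ENNReal.toReal_pos wD.1 wD.2
    have et : (t w).toReal = ((c w.2.2).toReal)⁻¹ * ((A (w.1 + w.2.2)).toReal *
        (B (w.2.1 + w.2.2)).toReal * ((D (w.1 + (w.2.1 + w.2.2))).toReal)⁻¹) := by
      simp [t, ENNReal.toReal_mul, ENNReal.toReal_inv]
    have := Real.log_le_sub_one_of_pos (x := (t w).toReal) (by rw [et]; positivity)
    refine le_trans (le_of_eq ?_) this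
    rw [et, Real.log_mul (by positivity) (by positivity), Real.log_mul (by positivity)
      (by positivity), Real.log_mul (by positivity) (by positivity), Real.log_inv, Real.log_inv]
    simp only [Pi.sub_apply]
    ring
  · rw [integral_sub it (integrable_const 1)]
    simpa using htReal

/-- Submodularity of the entropy of sums: for independent random vectors `X, Y, Z` in ℝⁿ
with densities `p, q, r`, one has `h(X+Y+Z) + h(Z) ≤ h(X+Z) + h(Y+Z)`.
Sums of independent random vectors have convolutions as densities. -/
theorem stmt_12 (n : ℕ) (p q r : (Fin n → ℝ) → ℝ)
    (hp : ∀ x, 0 ≤ p x) (hq : ∀ x, 0 ≤ q x) (hr : ∀ x, 0 ≤ r x)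
    (hp1 : ∫ x, p x = 1) (hq1 : ∫ x, q x = 1) (hr1 : ∫ x, r x = 1)
    (pq pr qr pqr : (Fin n → ℝ) → ℝ)
    (hpq : pq = fun x => ∫ y, p (x - y) * q y)
    (hpr : pr = fun x => ∫ y, p (x - y) * r y)
    (hqr : qr = fun x => ∫ y, q (x - y) * r y)
    (hpqr : pqr = fun x => ∫ y, pq (x - y) * r y)
    (h1 : Integrable fun x => p x * Real.log (p x))
    (h2 : Integrable fun x => q x * Real.log (q x))
    (h3 : Integrable fun x => r x * Real.log (r x))
    (h4 : Integrable fun x => pq x * Real.log (pq x))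
    (h5 : Integrable fun x => pr x * Real.log (pr x))
    (h6 : Integrable fun x => qr x * Real.log (qr x))
    (h7 : Integrable fun x => pqr x * Real.log (pqr x)) :
    (-∫ x, pqr x * Real.log (pqr x)) + (-∫ x, r x * Real.log (r x)) ≤
      (-∫ x, pr x * Real.log (pr x)) + (-∫ x, qr x * Real.log (qr x)) := by
  obtain ⟨a, ma, a1, ea⟩ := aux_dens hp hp1
  obtain ⟨b, mb, b1, eb⟩ := aux_dens hq hq1
  obtain ⟨c, mc, c1, ec⟩ := aux_dens hr hr1
  have epq : ∀ x, pq x = ((b ⋆ₗ a) x).toReal := fun x => by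
    rw [hpq]; exact aux_bridge hp hq ma mb ea eb x
  have epr : ∀ x, pr x = ((a ⋆ₗ c) x).toReal := fun x => by
    rw [hpr, lconvolution_comm]; exact aux_bridge hp hr ma mc ea ec x
  have eqr : ∀ x, qr x = ((b ⋆ₗ c) x).toReal := fun x => by
    rw [hqr, lconvolution_comm]; exact aux_bridge hq hr mb mc eb ec x
  have mpq : Measurable (b ⋆ₗ a) := measurable_lconvolution volume mb ma
  have epqr : ∀ x, pqr x = ((a ⋆ₗ (b ⋆ₗ c)) x).toReal := fun x => by
    have := aux_bridge (f := pq) (fun x => by rw [epq]; exact ENNReal.toReal_nonneg) hr mpq mc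
      (aux_ofReal mpq (aux_lconv_one ma mb a1 b1) epq) ec x
    rw [hpqr, lconvolution_assoc ma mb mc, lconvolution_comm,
      lconvolution_comm (f := a) (g := b)]
    exact this
  have er : (fun x => r x * Real.log (r x)) =ᵐ[volume]
      fun x => (c x).toReal * Real.log (c x).toReal := by
    filter_upwards [ec] with x hx
    rw [← hx, ENNReal.toReal_ofReal (hr x)]
  simp only [epr] at h5 ⊢
  simp only [eqr] at h6 ⊢
  simp only [epqr] at h7 ⊢
  rw [integral_congr_ae er]
  have := aux_core ma mb mc a1 b1 c1 rfl rfl rfl h5 h6 (h3.congr er) h7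
  linarith
end

section
/- Let X and Y be independent identically distributed random vectors in ℝⁿ with finite differential entropies, such that all entropies appearing are well-defined and finite. Then h(X+Y) + h(X) ≤ 2 h(X−Y). -/
open MeasureTheory Real

namespace Stmt13

open scoped ENNReal

/-- Change of variables for the law of a sum. -/
lemma sum_law {n : ℕ} (μ : Measure (Fin n → ℝ)) [SFinite μ] (u g : (Fin n → ℝ) → ℝ≥0∞)
    (hu : Measurable u) (hg : Measurable g) :
    ∫⁻ y, ∫⁻ x, u x * g (x + y) ∂volume ∂μ = ∫⁻ w, (∫⁻ y, u (w - y) ∂μ) * g w := by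
  have h1 : ∀ y, ∫⁻ x, u x * g (x + y) = ∫⁻ w, u (w - y) * g w := by
    intro y
    rw [← lintegral_add_right_eq_self (fun w => u (w - y) * g w) y]
    simp
  simp_rw [h1]
  rw [lintegral_lintegral_swap]
  · refine lintegral_congr fun w => ?_
    rw [lintegral_mul_const]
    fun_prop
  · apply Measurable.aemeasurable
    unfold Function.uncurry
    fun_prop

/-- Change of variables for the law of a difference. -/
lemma diff_law {n : ℕ} (μ : Measure (Fin n → ℝ)) [SFinite μ] (u g : (Fin n → ℝ) → ℝ≥0∞)
    (hu : Measurable u) (hg : Measurable g) :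
    ∫⁻ y, ∫⁻ x, u x * g (x - y) ∂volume ∂μ = ∫⁻ w, (∫⁻ y, u (w + y) ∂μ) * g w := by
  have h1 : ∀ y, ∫⁻ x, u x * g (x - y) = ∫⁻ w, u (w + y) * g w := by
    intro y
    rw [← lintegral_sub_right_eq_self (fun w => u (w + y) * g w) y]
    simp
  simp_rw [h1]
  rw [lintegral_lintegral_swap]
  · refine lintegral_congr fun w => ?_
    rw [lintegral_mul_const]
    fun_prop
  · apply Measurable.aemeasurable
    unfold Function.uncurry
    fun_prop

lemma map_eq {Ω E : Type*} [MeasurableSpace Ω] [MeasurableSpace E] (ν : Measure E)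
    (P : Measure Ω) (φ : Ω → E) (hφ : Measurable φ)
    (G : E → ℝ≥0∞) (hG : Measurable G)
    (h : ∀ g : E → ℝ≥0∞, Measurable g → ∫⁻ q, g (φ q) ∂P = ∫⁻ w, G w * g w ∂ν) :
    P.map φ = ν.withDensity G := by
  refine Measure.ext_of_lintegral _ fun g hg => ?_
  rw [lintegral_map hg hφ, h g hg, lintegral_withDensity_eq_lintegral_mul _ hG hg]
  rfl

lemma law_facts {Ω E : Type*} [MeasurableSpace Ω] [MeasurableSpace E] (ν : Measure E)
    (P : Measure Ω) [IsProbabilityMeasure P] (φ : Ω → E) (hφ : Measurable φ)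
    (G : E → ℝ≥0∞) (hG : Measurable G) (h : P.map φ = ν.withDensity G) :
    ∫⁻ w, G w ∂ν = 1 ∧ (∀ᵐ q ∂P, G (φ q) ≠ 0 ∧ G (φ q) ≠ ∞) ∧
    (Integrable (fun x => (G x).toReal * Real.log (G x).toReal) ν →
      Integrable (fun q => Real.log (G (φ q)).toReal) P ∧
      ∫ q, Real.log (G (φ q)).toReal ∂P = ∫ x, (G x).toReal * Real.log (G x).toReal ∂ν) := by
  have h1 : ∫⁻ w, G w ∂ν = 1 := by
    have := congrArg (fun m => m Set.univ) h
    simp only [Measure.map_apply hφ MeasurableSet.univ, Set.preimage_univ, measure_univ,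
      withDensity_apply _ MeasurableSet.univ, Measure.restrict_univ] at this
    exact this.symm
  have hfin : ∀ᵐ x ∂ν, G x < ∞ := ae_lt_top hG (by simp [h1])
  refine ⟨h1, ?_, ?_⟩
  · refine ae_of_ae_map (p := fun x => G x ≠ 0 ∧ G x ≠ ∞) hφ.aemeasurable ?_
    rw [h, ae_withDensity_iff hG]
    filter_upwards [hfin] with x hx h0
    exact ⟨h0, hx.ne⟩
  · intro hi
    have hm : Measurable fun x => Real.log (G x).toReal := by fun_prop
    constructor
    · have : Integrable (fun x => Real.log (G x).toReal) (P.map φ) := by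
        rw [h, integrable_withDensity_iff_integrable_smul' hG hfin]
        simpa using hi
      exact (integrable_map_measure hm.aestronglyMeasurable hφ.aemeasurable).1 this
    · rw [← integral_map (f := fun x => Real.log (G x).toReal) hφ.aemeasurable
        hm.aestronglyMeasurable, h, integral_withDensity_eq_integral_toReal_smul hG hfin]
      simp

lemma core {n : ℕ} (f : (Fin n → ℝ) → ℝ≥0∞) (hf : Measurable f) (hf1 : ∫⁻ x, f x = 1)
    (μ : Measure (Fin n → ℝ)) (hμ : μ = volume.withDensity f)
    (S D : (Fin n → ℝ) → ℝ≥0∞)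
    (hS : S = fun w => ∫⁻ y, f (w - y) ∂μ) (hD : D = fun w => ∫⁻ y, f (w + y) ∂μ)
    (h1 : Integrable fun x => (f x).toReal * Real.log (f x).toReal)
    (h2 : Integrable fun x => (S x).toReal * Real.log (S x).toReal)
    (h3 : Integrable fun x => (D x).toReal * Real.log (D x).toReal) :
    (-∫ x, (S x).toReal * Real.log (S x).toReal) + (-∫ x, (f x).toReal * Real.log (f x).toReal) ≤
      2 * (-∫ x, (D x).toReal * Real.log (D x).toReal) := by
  have hprob : IsProbabilityMeasure μ := ⟨by
    rw [hμ, withDensity_apply _ MeasurableSet.univ, Measure.restrict_univ, hf1]⟩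
  have hmuint : ∀ g : (Fin n → ℝ) → ℝ≥0∞, Measurable g →
      ∫⁻ x, g x ∂μ = ∫⁻ x, f x * g x := by
    intro g hg
    rw [hμ, lintegral_withDensity_eq_lintegral_mul _ hf hg]; rfl
  have hSm : Measurable S := by
    rw [hS]
    exact Measurable.lintegral_prod_right' (f := fun q : (Fin n → ℝ) × (Fin n → ℝ) =>
      f (q.1 - q.2)) (by fun_prop)
  have hDm : Measurable D := by
    rw [hD]
    exact Measurable.lintegral_prod_right' (f := fun q : (Fin n → ℝ) × (Fin n → ℝ) =>
      f (q.1 + q.2)) (by fun_prop)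
  set t : (Fin n → ℝ) → ℝ≥0∞ := fun w => ∫⁻ x, D (w - x) ∂μ with ht
  have htm : Measurable t := 
    Measurable.lintegral_prod_right' (f := fun q : (Fin n → ℝ) × (Fin n → ℝ) =>
      D (q.1 - q.2)) (by fun_prop)
  -- two-fold laws
  have hsum : ∀ g : (Fin n → ℝ) → ℝ≥0∞, Measurable g →
      ∫⁻ y, ∫⁻ x, g (x + y) ∂μ ∂μ = ∫⁻ w, S w * g w := by
    intro g hg
    rw [hS, ← sum_law μ f g hf hg]
    exact lintegral_congr fun y => hmuint _ (by fun_prop)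
  have hdiff : ∀ g : (Fin n → ℝ) → ℝ≥0∞, Measurable g →
      ∫⁻ y, ∫⁻ x, g (x - y) ∂μ ∂μ = ∫⁻ w, D w * g w := by
    intro g hg
    rw [hD, ← diff_law μ f g hf hg]
    exact lintegral_congr fun y => hmuint _ (by fun_prop)
  -- the triple product, coordinates (z, y, x)
  set P : Measure ((Fin n → ℝ) × (Fin n → ℝ) × (Fin n → ℝ)) := μ.prod (μ.prod μ) with hP
  have hP3 : ∀ F : (Fin n → ℝ) × (Fin n → ℝ) × (Fin n → ℝ) → ℝ≥0∞, Measurable F →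
      ∫⁻ q, F q ∂P = ∫⁻ z, ∫⁻ y, ∫⁻ x, F (z, y, x) ∂μ ∂μ ∂μ := by
    intro F hF
    rw [hP, lintegral_prod _ hF.aemeasurable]
    refine lintegral_congr fun z => ?_
    rw [lintegral_prod]
    exact (hF.comp measurable_prodMk_left).aemeasurable
  have LS := law_facts volume P (fun q => q.2.2 + q.2.1) (by fun_prop) S hSm
    (map_eq _ _ _ (by fun_prop) _ hSm fun g hg => by
      rw [hP3 _ (by fun_prop), ← hsum g hg]; simp)
  have LD1 := law_facts volume P (fun q => q.2.2 - q.1) (by fun_prop) D hDm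
    (map_eq _ _ _ (by fun_prop) _ hDm fun g hg => by
      rw [hP3 _ (by fun_prop), ← hdiff g hg]; simp)
  have LD2 := law_facts volume P (fun q => q.2.1 - q.1) (by fun_prop) D hDm
    (map_eq _ _ _ (by fun_prop) _ hDm fun g hg => by
      rw [hP3 _ (by fun_prop), ← hdiff g hg]; simp)
  have Lf := law_facts volume P (fun q => q.1) (by fun_prop) f hf
    (map_eq _ _ _ (by fun_prop) _ hf fun g hg => by
      rw [hP3 _ (by fun_prop), ← hmuint g hg]; simp)
  have Lt := law_facts volume P (fun q => q.2.2 + q.2.1 - q.1) (by fun_prop) t htm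
    (map_eq _ _ _ (by fun_prop) _ htm fun g hg => by
      rw [hP3 _ (by fun_prop), ht, ← sum_law μ D g hDm hg, lintegral_lintegral_swap]
      · refine lintegral_congr fun y => ?_
        rw [← hdiff (fun w => g (w + y)) (by fun_prop)]
        refine lintegral_congr fun z => lintegral_congr fun x => ?_
        congr 1; abel
      · apply Measurable.aemeasurable
        exact Measurable.lintegral_prod_right'
          (f := fun q : ((Fin n → ℝ) × (Fin n → ℝ)) × (Fin n → ℝ) =>
            g (q.2 + q.1.2 - q.1.1)) (by fun_prop))
  -- the two ratios
  set A : (Fin n → ℝ) × (Fin n → ℝ) × (Fin n → ℝ) → ℝ≥0∞ :=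
    fun q => t (q.2.2 + q.2.1 - q.1) * (S (q.2.2 + q.2.1))⁻¹ with hA
  set B : (Fin n → ℝ) × (Fin n → ℝ) × (Fin n → ℝ) → ℝ≥0∞ :=
    fun q => (f q.1)⁻¹ * (D (q.2.2 - q.1) * D (q.2.1 - q.1) * (t (q.2.2 + q.2.1 - q.1))⁻¹) with hB
  have hAm : Measurable A := by fun_prop
  have hBm : Measurable B := by fun_prop
  have hA1 : ∫⁻ q, A q ∂P ≤ 1 := by
    rw [hP3 _ hAm]
    calc _ ≤ ∫⁻ z, 1 ∂μ := by
          refine lintegral_mono fun z => ?_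
          simp only [hA]
          rw [hsum (fun w => t (w - z) * (S w)⁻¹) (by fun_prop), ← Lt.1,
            ← lintegral_sub_right_eq_self t z]
          refine lintegral_mono fun w => ?_
          calc S w * (t (w - z) * (S w)⁻¹) = t (w - z) * (S w * (S w)⁻¹) := by ring
            _ ≤ t (w - z) * 1 := by gcongr; exact ENNReal.mul_inv_le_one _
            _ = _ := mul_one _
      _ = 1 := by simp
  have hB1 : ∫⁻ q, B q ∂P ≤ 1 := by
    let H : (Fin n → ℝ) → (Fin n → ℝ) → (Fin n → ℝ) → ℝ≥0∞ :=
      fun z y x => D (x - z) * D (y - z) * (t (x + y - z))⁻¹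
    have hH : Measurable fun q : ((Fin n → ℝ) × (Fin n → ℝ)) × (Fin n → ℝ) =>
      H q.1.1 q.1.2 q.2 := by fun_prop
    have hH2 : Measurable fun q : (Fin n → ℝ) × (Fin n → ℝ) => ∫⁻ x, H q.1 q.2 x ∂μ :=
      Measurable.lintegral_prod_right' hH
    have hH3 : Measurable fun z : (Fin n → ℝ) => ∫⁻ y, ∫⁻ x, H z y x ∂μ ∂μ :=
      Measurable.lintegral_prod_right' hH2
    rw [hP3 _ hBm]
    calc _ = ∫⁻ z, (f z)⁻¹ * (∫⁻ y, ∫⁻ x, H z y x ∂μ ∂μ) ∂μ := by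
          refine lintegral_congr fun z => ?_
          have hz : Measurable fun y => ∫⁻ x, H z y x ∂μ := hH2.comp measurable_prodMk_left
          rw [← lintegral_const_mul _ hz]
          refine lintegral_congr fun y => ?_
          rw [← lintegral_const_mul _ (by fun_prop)]
      _ = ∫⁻ z, f z * ((f z)⁻¹ * (∫⁻ y, ∫⁻ x, H z y x ∂μ ∂μ)) :=
          hmuint _ (by fun_prop)
      _ ≤ ∫⁻ z, (∫⁻ y, ∫⁻ x, H z y x ∂μ ∂μ) := by
          refine lintegral_mono fun z => ?_
          simp only
          rw [← mul_assoc]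
          exact (mul_le_mul_left (ENNReal.mul_inv_le_one (f z)) _).trans_eq (one_mul _)
      _ = ∫⁻ y, ∫⁻ z, ∫⁻ x, H z y x ∂μ ∂volume ∂μ :=
          lintegral_lintegral_swap hH2.aemeasurable
      _ = ∫⁻ y, ∫⁻ x, ∫⁻ z, H z y x ∂volume ∂μ ∂μ := by
          refine lintegral_congr fun y => lintegral_lintegral_swap ?_
          apply Measurable.aemeasurable
          unfold Function.uncurry
          fun_prop
      _ = ∫⁻ y, ∫⁻ x, ∫⁻ w, (t w)⁻¹ * D (w - y) * D (w - x) ∂volume ∂μ ∂μ := by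
          refine lintegral_congr fun y => lintegral_congr fun x => ?_
          rw [← lintegral_sub_left_eq_self _ (x + y)]
          refine lintegral_congr fun w => ?_
          simp only [H]
          rw [show x - (x + y - w) = w - y by abel, show y - (x + y - w) = w - x by abel,
            show x + y - (x + y - w) = w by abel]
          ring
      _ = ∫⁻ y, ∫⁻ w, (t w)⁻¹ * D (w - y) * t w ∂volume ∂μ := by
          refine lintegral_congr fun y => ?_
          rw [lintegral_lintegral_swap]
          · refine lintegral_congr fun w => ?_
            rw [lintegral_const_mul _ (by fun_prop)]
          · apply Measurable.aemeasurable
            unfold Function.uncurry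
            fun_prop
      _ = ∫⁻ w, (t w)⁻¹ * t w * t w := by
          rw [lintegral_lintegral_swap]
          · refine lintegral_congr fun w => ?_
            rw [lintegral_mul_const _ (by fun_prop), lintegral_const_mul _ (by fun_prop)]
          · apply Measurable.aemeasurable
            unfold Function.uncurry
            fun_prop
      _ ≤ ∫⁻ w, t w := by
          refine lintegral_mono fun w => ?_
          calc (t w)⁻¹ * t w * t w ≤ 1 * t w := by gcongr; exact ENNReal.inv_mul_le_one _
            _ = _ := one_mul _
      _ = 1 := Lt.1
  have hAi : Integrable (fun q => (A q).toReal) P :=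
    integrable_toReal_of_lintegral_ne_top hAm.aemeasurable (hA1.trans_lt (by simp)).ne
  have hBi : Integrable (fun q => (B q).toReal) P :=
    integrable_toReal_of_lintegral_ne_top hBm.aemeasurable (hB1.trans_lt (by simp)).ne
  have hAI : ∫ q, (A q).toReal ∂P ≤ 1 := by
    rw [integral_toReal hAm.aemeasurable (ae_lt_top hAm (hA1.trans_lt (by simp)).ne)]
    exact ENNReal.toReal_mono (by simp) hA1
  have hBI : ∫ q, (B q).toReal ∂P ≤ 1 := by
    rw [integral_toReal hBm.aemeasurable (ae_lt_top hBm (hB1.trans_lt (by simp)).ne)]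
    exact ENNReal.toReal_mono (by simp) hB1
  obtain ⟨iS, eS⟩ := LS.2.2 h2
  obtain ⟨iD1, eD1⟩ := LD1.2.2 h3
  obtain ⟨iD2, eD2⟩ := LD2.2.2 h3
  obtain ⟨iF, eF⟩ := Lf.2.2 h1
  have key := integral_mono_ae (μ := P) ((iD1.add iD2).sub (iS.add iF))
    ((hAi.add hBi).sub (integrable_const (2 : ℝ))) (by
      filter_upwards [LS.2.1, LD1.2.1, LD2.2.1, Lf.2.1, Lt.2.1] with q a1 a2 a3 a4 a5
      have b1 := ENNReal.toReal_pos a1.1 a1.2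
      have b2 := ENNReal.toReal_pos a2.1 a2.2
      have b3 := ENNReal.toReal_pos a3.1 a3.2
      have b4 := ENNReal.toReal_pos a4.1 a4.2
      have b5 := ENNReal.toReal_pos a5.1 a5.2
      simp only [Pi.sub_apply, Pi.add_apply, hA, hB, ENNReal.toReal_mul, ENNReal.toReal_inv]
      generalize (S (q.2.2 + q.2.1)).toReal = r1 at *
      generalize (D (q.2.2 - q.1)).toReal = r2 at *
      generalize (D (q.2.1 - q.1)).toReal = r3 at *
      generalize (f q.1).toReal = r4 at *
      generalize (t (q.2.2 + q.2.1 - q.1)).toReal = r5 at *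
      have c1 := Real.log_le_sub_one_of_pos (x := r5 * r1⁻¹) (by positivity)
      have c2 := Real.log_le_sub_one_of_pos (x := r4⁻¹ * (r2 * r3 * r5⁻¹)) (by positivity)
      rw [Real.log_mul (by positivity) (by positivity), Real.log_inv] at c1
      rw [Real.log_mul (by positivity) (by positivity), Real.log_mul (by positivity) (by positivity),
        Real.log_mul (by positivity) (by positivity), Real.log_inv, Real.log_inv] at c2
      linarith)
  rw [integral_sub' (iD1.add iD2) (iS.add iF), integral_sub' (hAi.add hBi) (integrable_const _),
    integral_add' iD1 iD2, integral_add' iS iF, integral_add' hAi hBi, eS, eD1, eD2, eF] at key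
  simp at key
  linarith

end Stmt13

/-- For i.i.d. random vectors `X, Y` in ℝⁿ with density `p`,
`h(X+Y) + h(X) ≤ 2 h(X−Y)`, where `X+Y` has density `s` and `X−Y` has density `d`. -/
theorem stmt_13 (n : ℕ) (p : (Fin n → ℝ) → ℝ)
    (hnn : ∀ x, 0 ≤ p x) (hpdf : ∫ x, p x = 1)
    (s d : (Fin n → ℝ) → ℝ)
    (hs : s = fun x => ∫ y, p (x - y) * p y)
    (hd : d = fun x => ∫ y, p (x + y) * p y)
    (h1 : Integrable fun x => p x * Real.log (p x))
    (h2 : Integrable fun x => s x * Real.log (s x))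
    (h3 : Integrable fun x => d x * Real.log (d x)) :
    (-∫ x, s x * Real.log (s x)) + (-∫ x, p x * Real.log (p x)) ≤
      2 * (-∫ x, d x * Real.log (d x)) := by
  have hp : Integrable p := by
    by_contra h
    rw [integral_undef h] at hpdf
    norm_num at hpdf
  have hpm := hp.aestronglyMeasurable
  let f : (Fin n → ℝ) → ENNReal := fun x => ENNReal.ofReal (hpm.mk p x)
  have hf : Measurable f := hpm.stronglyMeasurable_mk.measurable.ennreal_ofReal
  have hfp : ∀ᵐ x, f x = ENNReal.ofReal (p x) := by
    filter_upwards [hpm.ae_eq_mk] with x hx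
    simp only [f, ← hx]
  have hf1 : ∫⁻ x, f x = 1 := by
    rw [lintegral_congr_ae hfp, ← ofReal_integral_eq_lintegral_ofReal hp (by
      filter_upwards with x using hnn x), hpdf, ENNReal.ofReal_one]
  have hfr : ∀ᵐ x, (f x).toReal = p x := by
    filter_upwards [hfp] with x hx
    rw [hx, ENNReal.toReal_ofReal (hnn x)]
  set μ : Measure (Fin n → ℝ) := volume.withDensity f with hμ
  have hconv : ∀ φ : (Fin n → ℝ) → (Fin n → ℝ), MeasurePreserving φ volume volume →
      ∫ y, p (φ y) * p y = (∫⁻ y, f (φ y) ∂μ).toReal := by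
    intro φ hφ
    have hfφ : Measurable fun y => f (φ y) := hf.comp hφ.measurable
    have hpp : AEStronglyMeasurable (fun y => p (φ y) * p y) volume :=
      (hpm.comp_measurePreserving hφ).mul hpm
    rw [hμ, lintegral_withDensity_eq_lintegral_mul _ hf hfφ,
      integral_eq_lintegral_of_nonneg_ae (by
        filter_upwards with y using mul_nonneg (hnn _) (hnn _))
      hpp]
    congr 1
    refine lintegral_congr_ae ?_
    filter_upwards [hfp, hφ.quasiMeasurePreserving.ae hfp] with y hy1 hy2
    simp only [Pi.mul_apply, Function.comp_apply, hy1, hy2]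
    rw [ENNReal.ofReal_mul (hnn _), mul_comm]
  have hs' : s = fun x => (∫⁻ y, f (x - y) ∂μ).toReal := by
    rw [hs]; funext x
    exact hconv (fun y => x - y) (Measure.measurePreserving_sub_left volume x)
  have hd' : d = fun x => (∫⁻ y, f (x + y) ∂μ).toReal := by
    rw [hd]; funext x
    exact hconv (fun y => x + y) (measurePreserving_add_left volume x)
  have hpl : (fun x => p x * Real.log (p x)) =ᵐ[volume]
      fun x => (f x).toReal * Real.log (f x).toReal := by
    filter_upwards [hfr] with x hx
    rw [hx]
  rw [integral_congr_ae hpl]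
  subst hs' hd'
  exact Stmt13.core f hf hf1 μ hμ _ _ rfl rfl (h1.congr hpl) h2 h3
end

section
/- Let X and Y be independent random vectors in ℝⁿ with log-concave densities, identically distributed. Then h(X−Y) ≤ h(X) + n and h(X+Y) ≤ h(X) + 2n. -/
open MeasureTheory Real

section Helpers
open scoped ENNReal Pointwise

lemma bm_compact {t : ℝ} (h0 : 0 < t) (h1 : t < 1) {K L C : Set ℝ}
    (hK : IsCompact K) (hL : IsCompact L) (hKn : K.Nonempty) (hLn : L.Nonempty)
    (hC : ∀ a ∈ K, ∀ b ∈ L, t * a + (1 - t) * b ∈ C) :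
    ENNReal.ofReal t * volume K + ENNReal.ofReal (1 - t) * volume L ≤ volume C := by
  obtain ⟨k, hkK, hk⟩ := hK.exists_isGreatest hKn
  obtain ⟨l, hlL, hl⟩ := hL.exists_isLeast hLn
  have key : ∀ (r c : ℝ) (S : Set ℝ), 0 < r →
      volume ((fun x => c + x) '' (r • S)) = ENNReal.ofReal r * volume S := by
    intro r c S hr
    rw [Set.image_add_left, measure_preimage_add, Measure.addHaar_smul]
    simp [abs_of_pos hr]
  have h1' : 0 < 1 - t := by linarith
  rw [← key t ((1 - t) * l) K h0, ← key (1 - t) (t * k) L h1']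
  set A := (fun x => (1 - t) * l + x) '' (t • K)
  set B := (fun x => t * k + x) '' ((1 - t) • L)
  have hBm : MeasurableSet B := by
    have : IsCompact B := (hL.smul (1 - t)).image (by fun_prop)
    exact this.measurableSet
  have hAB : volume (A ∩ B) = 0 := by
    refine measure_mono_null (t := {t * k + (1 - t) * l}) ?_ (by simp)
    rintro x ⟨⟨_, ⟨a, ha, rfl⟩, rfl⟩, ⟨_, ⟨b, hb, rfl⟩, h⟩⟩
    have e1 := hk ha
    have e2 := hl hb
    simp only [smul_eq_mul] at h ⊢
    have e3 : t * a ≤ t * k := mul_le_mul_of_nonneg_left e1 h0.le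
    have e4 : (1 - t) * l ≤ (1 - t) * b := mul_le_mul_of_nonneg_left e2 h1'.le
    simp only [Set.mem_singleton_iff]
    linarith
  have := measure_union_add_inter (μ := volume) A hBm
  rw [hAB, add_zero] at this
  rw [← this]
  apply measure_mono
  rintro x (⟨_, ⟨a, ha, rfl⟩, rfl⟩ | ⟨_, ⟨b, hb, rfl⟩, rfl⟩)
  · have := hC a ha l hlL
    simpa [add_comm] using this
  · have := hC k hkK b hb
    simpa using this

lemma bm_one {t : ℝ} (h0 : 0 < t) (h1 : t < 1) {A B C : Set ℝ}
    (hA : MeasurableSet A) (hB : MeasurableSet B) (hAn : A.Nonempty) (hBn : B.Nonempty)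
    (hC : ∀ a ∈ A, ∀ b ∈ B, t * a + (1 - t) * b ∈ C) :
    ENNReal.ofReal t * volume A + ENNReal.ofReal (1 - t) * volume B ≤ volume C := by
  obtain ⟨a, ha⟩ := hAn
  obtain ⟨b, hb⟩ := hBn
  have step : ∀ (S : Set ℝ), MeasurableSet S → ∀ s ∈ S, ∀ r < volume S,
      ∃ K ⊆ S, IsCompact K ∧ K.Nonempty ∧ r ≤ volume K := by
    intro S hS s hs r hr
    obtain ⟨K, hKS, hK, hr'⟩ := hS.exists_lt_isCompact hr
    refine ⟨K ∪ {s}, by simp [Set.insert_subset_iff, hs, hKS], hK.union isCompact_singleton,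
      ⟨s, by simp⟩, hr'.le.trans (measure_mono Set.subset_union_left)⟩
  have hb0 : ∀ (S : Set ℝ), MeasurableSet S → ∀ s ∈ S,
      volume S = ⨆ K : {K : Set ℝ // K ⊆ S ∧ IsCompact K ∧ K.Nonempty}, volume K.1 := by
    intro S hS s hs
    apply le_antisymm
    · apply le_of_forall_lt
      intro r hr
      obtain ⟨r', hr1, hr2⟩ := exists_between hr
      obtain ⟨K, h1, h2, h3, h4⟩ := step S hS s hs r' hr2
      exact (hr1.trans_le h4).trans_le (le_iSup (fun K : {K : Set ℝ // K ⊆ S ∧ IsCompact K ∧ K.Nonempty} => volume K.1) ⟨K, h1, h2, h3⟩)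
    · exact iSup_le fun K => measure_mono K.2.1
  rw [hb0 A hA a ha, hb0 B hB b hb, ENNReal.mul_iSup, ENNReal.mul_iSup]
  have : Nonempty {K : Set ℝ // K ⊆ A ∧ IsCompact K ∧ K.Nonempty} :=
    ⟨{a}, by simpa using ha, isCompact_singleton, by simp⟩
  have : Nonempty {K : Set ℝ // K ⊆ B ∧ IsCompact K ∧ K.Nonempty} :=
    ⟨{b}, by simpa using hb, isCompact_singleton, by simp⟩
  apply ENNReal.iSup_add_iSup_le
  rintro ⟨K, hK⟩ ⟨L, hL⟩
  exact bm_compact h0 h1 hK.2.1 hL.2.1 hK.2.2 hL.2.2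
    fun a ha b hb => hC a (hK.1 ha) b (hL.1 hb)

lemma layer {f : ℝ → ℝ≥0∞} (hf : Measurable f) (hf1 : ∀ x, f x ≤ 1) :
    ∫⁻ x, f x = ∫⁻ r in Set.Ioo (0:ℝ) 1, volume {x | ENNReal.ofReal r ≤ f x} := by
  have hfin : ∀ x, f x ≠ ∞ := fun x => ne_top_of_le_ne_top ENNReal.one_ne_top (hf1 x)
  have e := lintegral_eq_lintegral_meas_le (volume : Measure ℝ) (f := fun x => (f x).toReal)
    (Filter.Eventually.of_forall fun x => ENNReal.toReal_nonneg) hf.ennreal_toReal.aemeasurable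
  have e1 : ∀ x, ENNReal.ofReal (f x).toReal = f x := fun x => ENNReal.ofReal_toReal (hfin x)
  have e2 : ∀ r : ℝ, {x | r ≤ (f x).toReal} = {x | ENNReal.ofReal r ≤ f x} := by
    intro r
    ext x
    exact (ENNReal.ofReal_le_iff_le_toReal (hfin x)).symm
  simp_rw [e1, e2] at e
  rw [e]
  rw [← Set.Ioc_union_Ioi_eq_Ioi (zero_le_one' ℝ), lintegral_union measurableSet_Ioi
    (Set.disjoint_left.2 fun x hx hx' => by simp at hx hx'; linarith)]
  have z : ∫⁻ r in Set.Ioi (1:ℝ), volume {x | ENNReal.ofReal r ≤ f x} = 0 := by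
    rw [setLIntegral_congr_fun (g := fun _ => 0) measurableSet_Ioi]
    · simp
    · intro r hr
      have : {x | ENNReal.ofReal r ≤ f x} = ∅ := by
        ext x
        simp only [Set.mem_ofPred_eq, Set.mem_empty_iff_false, iff_false, not_le]
        exact (hf1 x).trans_lt (by simpa using hr)
      simp [this]
  rw [z, add_zero]
  exact setLIntegral_congr Ioo_ae_eq_Ioc.symm

lemma pl_core {t : ℝ} (h0 : 0 < t) (h1 : t < 1) {f g h : ℝ → ℝ≥0∞}
    (hf : Measurable f) (hg : Measurable g) (hh : Measurable h)
    (hf1 : ∀ x, f x ≤ 1) (hg1 : ∀ x, g x ≤ 1)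
    (hfs : ∀ r < 1, ∃ x, r ≤ f x) (hgs : ∀ r < 1, ∃ x, r ≤ g x)
    (H : ∀ r a b, r ≤ f a → r ≤ g b → r ≤ h (t * a + (1 - t) * b)) :
    ENNReal.ofReal t * (∫⁻ x, f x) + ENNReal.ofReal (1 - t) * (∫⁻ x, g x) ≤ ∫⁻ x, h x := by
  have hm : ∫⁻ x, min (h x) 1 ≤ ∫⁻ x, h x := lintegral_mono fun x => min_le_left _ _
  refine le_trans ?_ hm
  rw [layer hf hf1, layer hg hg1, layer (hh.min measurable_const) (fun x => min_le_right _ _)]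
  have am : ∀ u : ℝ → ℝ≥0∞, Measurable fun r : ℝ => volume {x | ENNReal.ofReal r ≤ u x} := by
    intro u
    apply Antitone.measurable
    intro r s hrs
    exact measure_mono fun x hx => (ENNReal.ofReal_le_ofReal hrs).trans hx
  rw [← lintegral_const_mul _ (am f), ← lintegral_const_mul _ (am g),
    ← lintegral_add_left ((am f).const_mul _)]
  apply setLIntegral_mono ((am _))
  intro r hr
  have hr1 : ENNReal.ofReal r < 1 := by simpa using hr.2
  refine bm_one h0 h1 (measurableSet_le measurable_const hf) (measurableSet_le measurable_const hg)
    (hfs _ hr1) (hgs _ hr1) ?_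
  intro a ha b hb
  exact le_min (H _ a b ha hb) hr1.le

lemma rpow_split (r : ℝ≥0∞) {t : ℝ} (h0 : 0 < t) (h1 : t < 1) : r ^ t * r ^ (1 - t) = r := by
  rw [← ENNReal.rpow_add_of_nonneg _ _ h0.le (by linarith)]
  simp

lemma amgm {t : ℝ} (h0 : 0 < t) (h1 : t < 1) (a b : ℝ≥0∞) :
    a ^ t * b ^ (1 - t) ≤ ENNReal.ofReal t * a + ENNReal.ofReal (1 - t) * b := by
  have h1' : 0 < 1 - t := by linarith
  by_cases ha : a = ∞
  · have : ENNReal.ofReal t * a = ∞ := by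
      rw [ha, ENNReal.mul_top]; simpa using h0
    rw [this]; simp
  by_cases hb : b = ∞
  · have : ENNReal.ofReal (1 - t) * b = ∞ := by
      rw [hb, ENNReal.mul_top]; simpa using h1
    rw [this]; simp
  lift a to NNReal using ha
  lift b to NNReal using hb
  have := NNReal.geom_mean_le_arith_mean2_weighted (Real.toNNReal t) (Real.toNNReal (1 - t)) a b
    (by rw [← Real.toNNReal_add h0.le h1'.le]; simp)
  rw [← ENNReal.coe_rpow_of_nonneg _ h0.le, ← ENNReal.coe_rpow_of_nonneg _ h1'.le]
  rw [Real.coe_toNNReal _ h0.le, Real.coe_toNNReal _ h1'.le] at this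
  unfold ENNReal.ofReal
  exact_mod_cast this

lemma pl_bdd {t : ℝ} (h0 : 0 < t) (h1 : t < 1) {f g h : ℝ → ℝ≥0∞}
    (hf : Measurable f) (hg : Measurable g) (hh : Measurable h) {N : ℝ≥0∞} (hN : N ≠ ∞)
    (hfN : ∀ x, f x ≤ N) (hgN : ∀ x, g x ≤ N)
    (H : ∀ a b, f a ^ t * g b ^ (1 - t) ≤ h (t * a + (1 - t) * b)) :
    (∫⁻ x, f x) ^ t * (∫⁻ x, g x) ^ (1 - t) ≤ ∫⁻ x, h x := by
  have h1' : 0 < 1 - t := by linarith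
  set A := ⨆ x, f x with hA
  set B := ⨆ x, g x with hB
  have hAt : A ≠ ∞ := ne_top_of_le_ne_top hN (iSup_le hfN)
  have hBt : B ≠ ∞ := ne_top_of_le_ne_top hN (iSup_le hgN)
  by_cases hA0 : A = 0
  · have : ∀ x, f x = 0 := by simpa [hA] using hA0
    simp [this, h0]
  by_cases hB0 : B = 0
  · have : ∀ x, g x = 0 := by simpa [hB] using hB0
    simp [this, h1]
  have sup_ex : ∀ (u : ℝ → ℝ≥0∞) (S : ℝ≥0∞), S = ⨆ x, u x → S ≠ 0 → S ≠ ∞ →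
      (∀ x, u x * S⁻¹ ≤ 1) ∧ ∀ r < 1, ∃ x, r ≤ u x * S⁻¹ := by
    intro u S hS hS0 hSt
    refine ⟨fun x => ?_, fun r hr => ?_⟩
    · rw [← ENNReal.mul_inv_cancel hS0 hSt]
      gcongr
      rw [hS]; exact le_iSup u x
    · have : r * S < S := by
        calc r * S < 1 * S := by
              rw [mul_comm r, mul_comm 1]
              exact (ENNReal.mul_lt_mul_iff_right hS0 hSt).2 hr
          _ = S := one_mul S
      nth_rewrite 2 [hS] at this
      obtain ⟨x, hx⟩ := lt_iSup_iff.1 this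
      refine ⟨x, ?_⟩
      rw [← div_eq_mul_inv, ENNReal.le_div_iff_mul_le (Or.inl hS0) (Or.inl hSt)]
      exact hx.le
  obtain ⟨fa, fb⟩ := sup_ex f A hA hA0 hAt
  obtain ⟨ga, gb⟩ := sup_ex g B hB hB0 hBt
  have core := pl_core h0 h1 (f := fun x => f x * A⁻¹) (g := fun x => g x * B⁻¹)
    (h := fun x => h x * ((A⁻¹) ^ t * (B⁻¹) ^ (1 - t)))
    (hf.mul_const _) (hg.mul_const _) (hh.mul_const _) fa ga fb gb ?_
  · have := (amgm h0 h1 _ _).trans core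
    rw [lintegral_mul_const _ hf, lintegral_mul_const _ hg, lintegral_mul_const _ hh,
      ENNReal.mul_rpow_of_nonneg _ _ h0.le, ENNReal.mul_rpow_of_nonneg _ _ h1'.le,
      mul_mul_mul_comm] at this
    refine (ENNReal.mul_le_mul_iff_left ?_ ?_).1 this
    · apply mul_ne_zero <;> simp [ENNReal.rpow_eq_zero_iff, hAt, hBt, hA0, hB0]
    · apply ENNReal.mul_ne_top <;> simp [ENNReal.rpow_eq_top_iff, hAt, hBt, hA0, hB0]
  · intro r a b ha hb
    rw [← rpow_split r h0 h1]
    calc r ^ t * r ^ (1 - t) ≤ (f a * A⁻¹) ^ t * (g b * B⁻¹) ^ (1 - t) := by gcongr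
      _ = (f a ^ t * g b ^ (1 - t)) * ((A⁻¹) ^ t * (B⁻¹) ^ (1 - t)) := by
        rw [ENNReal.mul_rpow_of_nonneg _ _ h0.le, ENNReal.mul_rpow_of_nonneg _ _ h1'.le,
          mul_mul_mul_comm]
      _ ≤ _ := by gcongr; exact H a b

lemma pl_one {t : ℝ} (h0 : 0 < t) (h1 : t < 1) {f g h : ℝ → ℝ≥0∞}
    (hf : Measurable f) (hg : Measurable g) (hh : Measurable h)
    (H : ∀ a b, f a ^ t * g b ^ (1 - t) ≤ h (t * a + (1 - t) * b)) :
    (∫⁻ x, f x) ^ t * (∫⁻ x, g x) ^ (1 - t) ≤ ∫⁻ x, h x := by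
  have h1' : 0 < 1 - t := by linarith
  by_cases hf0 : ∫⁻ x, f x = 0
  · simp [hf0, h0]
  by_cases hg0 : ∫⁻ x, g x = 0
  · simp [hg0, h1]
  have lim : ∀ u : ℝ → ℝ≥0∞, Measurable u → Filter.Tendsto (fun N : ℕ => ∫⁻ x, min (u x) N)
      Filter.atTop (nhds (∫⁻ x, u x)) := by
    intro u hu
    apply lintegral_tendsto_of_tendsto_of_monotone
    · exact fun N => (hu.min measurable_const).aemeasurable
    · refine Filter.Eventually.of_forall fun x N M hNM => ?_
      simp only
      gcongr
    · refine Filter.Eventually.of_forall fun x => ?_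
      have : Filter.Tendsto (fun N : ℕ => min (u x) (N : ℝ≥0∞)) Filter.atTop (nhds (min (u x) ∞)) :=
        tendsto_const_nhds.min ENNReal.tendsto_nat_nhds_top
      simpa using this
  have hl : Filter.Tendsto (fun N : ℕ => (∫⁻ x, min (f x) N) ^ t * (∫⁻ x, min (g x) N) ^ (1 - t))
      Filter.atTop (nhds ((∫⁻ x, f x) ^ t * (∫⁻ x, g x) ^ (1 - t))) := by
    apply ENNReal.Tendsto.mul
    · exact (lim f hf).ennrpow_const t
    · left; simp [ENNReal.rpow_eq_zero_iff, hf0, h0.le, h0.not_gt]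
    · exact (lim g hg).ennrpow_const _
    · left; simp [ENNReal.rpow_eq_zero_iff, hg0, h1.le, h1'.le]
  refine le_of_tendsto' hl fun N => ?_
  refine pl_bdd h0 h1 (hf.min measurable_const) (hg.min measurable_const) hh
    (ENNReal.natCast_ne_top N) (fun x => min_le_right _ _) (fun x => min_le_right _ _) ?_
  intro a b
  refine le_trans ?_ (H a b)
  gcongr <;> exact min_le_left _ _

def LC {E : Type} [AddCommGroup E] [Module ℝ E] (f : E → ℝ≥0∞) : Prop :=
  ∀ x y : E, ∀ t : ℝ, 0 < t → t < 1 → f x ^ t * f y ^ (1 - t) ≤ f (t • x + (1 - t) • y)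

lemma LC.convex {E : Type} [AddCommGroup E] [Module ℝ E] {f : E → ℝ≥0∞} (hf : LC f) (a : ℝ≥0∞) :
    Convex ℝ {x | a ≤ f x} := by
  rw [convex_iff_forall_pos]
  intro x hx y hy s t hs ht hst
  have hs1 : s < 1 := by linarith
  obtain rfl : t = 1 - s := by linarith
  have := hf x y s hs hs1
  refine le_trans ?_ this
  rw [← rpow_split a hs hs1]
  have hx' : a ≤ f x := hx
  have hy' : a ≤ f y := hy
  gcongr

lemma LC.measurable {f : ℝ → ℝ≥0∞} (hf : LC f) : Measurable f := by
  apply measurable_of_Ici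
  intro a
  exact (hf.convex a).ordConnected.measurableSet

lemma LC.aemeasurable {E : Type} [NormedAddCommGroup E] [NormedSpace ℝ E] [MeasurableSpace E]
    [BorelSpace E] [FiniteDimensional ℝ E] (μ : Measure E) [μ.IsAddHaarMeasure]
    {f : E → ℝ≥0∞} (hf : LC f) : AEMeasurable f μ := by
  have : NullMeasurable f μ := by
    have h : @Measurable (NullMeasurableSpace E μ) _ _ _ f := by
      apply measurable_of_Ici
      intro a
      have h2 : NullMeasurableSet {x | a ≤ f x} μ :=
        nullMeasurableSet_of_null_frontier ((hf.convex a).addHaar_frontier μ)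
      exact h2
    exact h
  exact this.aemeasurable

lemma LC.comp {E E' : Type} [AddCommGroup E] [Module ℝ E] [AddCommGroup E'] [Module ℝ E']
    {f : E → ℝ≥0∞} (hf : LC f) (L : E' → E)
    (hL : ∀ x y (t : ℝ), L (t • x + (1 - t) • y) = t • L x + (1 - t) • L y) :
    LC fun x => f (L x) := by
  intro x y t h0 h1
  simp only [hL]
  exact hf _ _ t h0 h1

lemma LC.mul {E : Type} [AddCommGroup E] [Module ℝ E]
    {f g : E → ℝ≥0∞} (hf : LC f) (hg : LC g) : LC fun x => f x * g x := by
  intro x y t h0 h1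
  simp only
  rw [ENNReal.mul_rpow_of_nonneg _ _ h0.le, ENNReal.mul_rpow_of_nonneg _ _ (by linarith),
    mul_mul_mul_comm]
  exact mul_le_mul' (hf x y t h0 h1) (hg x y t h0 h1)

lemma LC.marg_one {E : Type} [AddCommGroup E] [Module ℝ E] {F : E × ℝ → ℝ≥0∞} (hF : LC F) :
    LC fun x => ∫⁻ y, F (x, y) := by
  have hm : ∀ x, Measurable fun y => F (x, y) := by
    intro x
    apply LC.measurable
    apply hF.comp
    intro a b t
    ext
    · simp [← add_smul]
    · simp
  intro x y t h0 h1
  refine pl_one h0 h1 (hm x) (hm y) (hm _) ?_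
  intro a b
  exact hF (x, a) (y, b) t h0 h1

lemma LC.marg_pi (m : ℕ) : ∀ {E : Type} [AddCommGroup E] [Module ℝ E]
    {F : E × (Fin m → ℝ) → ℝ≥0∞}, LC F → LC fun x => ∫⁻ y, F (x, y) := by
  induction m with
  | zero =>
    intro E _ _ F hF
    have : ∀ x, ∫⁻ y, F (x, y) = F (x, 0) := by
      intro x
      have e : ∀ y : Fin 0 → ℝ, F (x, y) = F (x, 0) := fun y => by
        rw [Subsingleton.elim y 0]
      simp_rw [e]
      rw [lintegral_const]
      simp [volume_pi, -Matrix.zero_empty]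
    simp_rw [this]
    apply hF.comp
    intro a b t
    apply Prod.ext
    · simp
    · exact Subsingleton.elim _ _
  | succ m ih =>
    intro E _ _ F hF
    have hG : LC (fun z : (E × ℝ) × (Fin m → ℝ) => F (z.1.1, Fin.cons z.1.2 z.2)) := by
      apply hF.comp
      intro a b t
      apply Prod.ext
      · simp
      · funext i
        refine Fin.cases ?_ (fun j => ?_) i <;> simp
    have h2 := (ih hG).marg_one
    convert h2 using 2 with x
    have mp := (volume_preserving_piFinSuccAbove (fun _ : Fin (m+1) => ℝ) 0).symm
    rw [← mp.lintegral_comp_emb (MeasurableEquiv.measurableEmbedding _), Measure.volume_eq_prod,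
      lintegral_prod]
    · refine lintegral_congr fun a => lintegral_congr fun b => ?_
      congr 2
      exact Fin.insertNth_zero' a b
    · rw [← Measure.volume_eq_prod]
      refine AEMeasurable.comp_measurable (f := (MeasurableEquiv.piFinSuccAbove (fun _ : Fin (m+1) => ℝ) 0).symm) (g := fun y => F (x, y)) ?_ (MeasurableEquiv.measurable _)
      rw [mp.map_eq]
      apply LC.aemeasurable
      apply hF.comp
      intro a b t
      ext
      · simp [← add_smul]
      · simp

lemma LC.ne_top {n : ℕ} {F : (Fin n → ℝ) → ℝ≥0∞} (hF : LC F) (h0 : ∫⁻ x, F x ≠ 0)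
    (hi : ∫⁻ x, F x ≠ ∞) (x₀ : Fin n → ℝ) : F x₀ ≠ ∞ := by
  intro hx
  have hae := ae_lt_top' (hF.aemeasurable volume) hi
  have hnull : volume {x | F x = ∞} = 0 := by
    rw [ae_iff] at hae
    simpa using hae
  apply h0
  have : F =ᵐ[volume] 0 := by
    rw [Filter.EventuallyEq, ae_iff]
    have : volume ((fun y => (1 / 2 : ℝ) • y) ⁻¹' ((fun y => (1 / 2 : ℝ) • x₀ + y) ⁻¹' {x | F x = ∞})) = 0 := by
      rw [Measure.addHaar_preimage_smul _ (by norm_num), measure_preimage_add, hnull, mul_zero]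
    refine measure_mono_null ?_ this
    intro y hy
    have hy : F y ≠ 0 := hy
    have h := hF x₀ y (1 / 2) (by norm_num) (by norm_num)
    rw [hx, ENNReal.top_rpow_of_pos (by norm_num), ENNReal.top_mul] at h
    · have := top_le_iff.1 h
      norm_num at this
      simpa using this
    · simp only [ne_eq, ENNReal.rpow_eq_zero_iff, hy, false_and, false_or, not_and, not_lt]
      intro _; norm_num
  rw [lintegral_congr_ae this]
  simp

lemma ent_lower {n : ℕ} {f : (Fin n → ℝ) → ℝ} (hf0 : ∀ x, 0 ≤ f x) (h1 : ∫ x, f x = 1)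
    (hlc : ∀ x y : Fin n → ℝ, ∀ t : ℝ, 0 < t → t < 1 →
      f x ^ t * f y ^ (1 - t) ≤ f (t • x + (1 - t) • y))
    (hl : Integrable fun x => f x * Real.log (f x)) (x₀ : Fin n → ℝ) (hx : 0 < f x₀) :
    Real.log (f x₀) - n ≤ ∫ x, f x * Real.log (f x) := by
  have hfi : Integrable f := by
    by_contra h
    rw [integral_undef h] at h1
    exact zero_ne_one h1
  set I := ∫ x, f x * Real.log (f x) with hI
  set M := f x₀ with hM
  have main : ∀ t : ℝ, 0 < t → t < 1 →
      1 + (t - 1) * I ≤ Real.exp (-(n * Real.log t) + (t - 1) * Real.log M) := by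
    intro t t0 t1
    have pw : ∀ x, (f x + (t - 1) * (f x * Real.log (f x))) * M ^ (1 - t)
        ≤ f (t • x + (1 - t) • x₀) := by
      intro x
      refine le_trans ?_ (hlc x x₀ t t0 t1)
      gcongr
      rcases (hf0 x).eq_or_lt with h | h
      · simp [← h, Real.zero_rpow t0.ne']
      · have e : f x ^ t = f x * Real.exp ((t - 1) * Real.log (f x)) := by
          rw [Real.rpow_def_of_pos h]
          nth_rewrite 2 [← Real.exp_log h]
          rw [← Real.exp_add]
          congr 1; ring
        rw [e]
        have := Real.add_one_le_exp ((t - 1) * Real.log (f x))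
        nlinarith
    have hshift : ∫ x, f (t • x + (1 - t) • x₀) = (t ^ n)⁻¹ := by
      have := Measure.integral_comp_smul (volume : Measure (Fin n → ℝ)) (fun x => f (x + (1 - t) • x₀)) t
      rw [this, integral_add_right_eq_self f, h1]
      simp [abs_of_pos t0]
    have hshi : Integrable fun x => f (t • x + (1 - t) • x₀) :=
      (hfi.comp_add_right ((1 - t) • x₀)).comp_smul t0.ne'
    have hI2 : Integrable fun x => (f x + (t - 1) * (f x * Real.log (f x))) :=
      hfi.add (hl.const_mul _)
    have := integral_mono (hI2.mul_const _) hshi pw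
    rw [hshift, integral_mul_const, integral_add hfi (hl.const_mul _), integral_const_mul, h1] at this
    have hMp : 0 < M ^ (1 - t) := Real.rpow_pos_of_pos hx _
    have e : Real.exp (-(n * Real.log t) + (t - 1) * Real.log M) = (t ^ n)⁻¹ / M ^ (1 - t) := by
      rw [Real.rpow_def_of_pos hx, div_eq_mul_inv, ← Real.exp_neg, Real.exp_add, Real.exp_neg]
      congr 1
      · rw [mul_comm, Real.exp_mul, Real.exp_log t0, Real.rpow_natCast]
      · congr 1; ring
    rw [e, le_div_iff₀ hMp]
    exact this
  have hd : HasDerivAt (fun t : ℝ => Real.exp (-(n * Real.log t) + (t - 1) * Real.log M)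
      - (1 + (t - 1) * I)) ((-n + Real.log M) - I) 1 := by
    have a1 : HasDerivAt (fun t : ℝ => -(n * Real.log t) + (t - 1) * Real.log M)
        (-(n * (1:ℝ)⁻¹) + 1 * Real.log M) 1 :=
      ((Real.hasDerivAt_log one_ne_zero).const_mul (n:ℝ)).neg.add
        (((hasDerivAt_id (1:ℝ)).sub_const 1).mul_const _)
    have a2 := (a1.exp).sub ((((hasDerivAt_id (1:ℝ)).sub_const 1).mul_const I).const_add 1)
    have e : Real.exp (-(n * Real.log 1) + (1 - 1) * Real.log M) * (-(n * (1:ℝ)⁻¹) + 1 * Real.log M)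
        - 1 * I = -n + Real.log M - I := by simp
    rw [e] at a2
    exact a2
  rw [hasDerivAt_iff_tendsto_slope] at hd
  have hd' := hd.mono_left (nhdsWithin_mono (1:ℝ) (s := Set.Iio 1) (fun x hx => ne_of_lt hx))
  have : -n + Real.log M - I ≤ 0 := by
    refine le_of_tendsto hd' ?_
    filter_upwards [Ioo_mem_nhdsLT (zero_lt_one' ℝ)] with t ht
    rw [slope_def_field]
    apply div_nonpos_of_nonneg_of_nonpos
    · simpa using main t ht.1 ht.2
    · linarith [ht.2]
  linarith

lemma jensen {n : ℕ} {f : (Fin n → ℝ) → ℝ} (hf0 : ∀ x, 0 ≤ f x) (h1 : ∫ x, f x = 1)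
    (h2 : Integrable fun x => f x * f x)
    (hl : Integrable fun x => f x * Real.log (f x)) :
    0 < ∫ x, f x * f x ∧ ∫ x, f x * Real.log (f x) ≤ Real.log (∫ x, f x * f x) := by
  have hfi : Integrable f := by
    by_contra h
    rw [integral_undef h] at h1
    exact zero_ne_one h1
  have hc : 0 < ∫ x, f x * f x := by
    have hnn : 0 ≤ ∫ x, f x * f x := integral_nonneg fun x => mul_self_nonneg _
    refine lt_of_le_of_ne hnn fun h => ?_
    have := (integral_eq_zero_iff_of_nonneg (fun x => mul_self_nonneg (f x)) h2).1 h.symm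
    have hz : f =ᵐ[volume] 0 := by
      filter_upwards [this] with x hx
      simpa using hx
    rw [integral_congr_ae hz] at h1
    simp at h1
  refine ⟨hc, ?_⟩
  set c := ∫ x, f x * f x with hcd
  have pw : ∀ x, f x * Real.log (f x) ≤ (f x * Real.log c + f x * f x / c) - f x := by
    intro x
    rcases (hf0 x).eq_or_lt with h | h
    · simp [← h]
    · have := Real.log_le_sub_one_of_pos (div_pos h hc)
      rw [Real.log_div h.ne' hc.ne'] at this
      have := mul_le_mul_of_nonneg_left this h.le
      have e : f x * (f x / c - 1) = f x * f x / c - f x := by ring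
      linarith [mul_sub (f x) (Real.log (f x)) (Real.log c)]
  have a1 := hfi.mul_const (Real.log c)
  have a2 := h2.div_const c
  have := integral_mono hl ((a1.add a2).sub hfi) pw
  have e : ∫ x, ((f x * Real.log c + f x * f x / c) - f x) = Real.log c := by
    have e0 : Integrable fun x => f x * Real.log c + f x * f x / c := a1.add a2
    rw [integral_sub e0 hfi, integral_add a1 a2, integral_mul_const, integral_div, h1,
      ← hcd, div_self hc.ne']
    ring
  exact this.trans_eq e

section conv
variable {n : ℕ} (P : (Fin n → ℝ) → ℝ≥0∞)

lemma mass_S (hP : Measurable P) : ∫⁻ x, ∫⁻ y, P (x - y) * P y = (∫⁻ x, P x) * ∫⁻ x, P x := by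
  rw [lintegral_lintegral_swap (by fun_prop)]
  have : ∀ y, ∫⁻ x, P (x - y) * P y = (∫⁻ x, P x) * P y := by
    intro y
    rw [lintegral_mul_const _ (by fun_prop), lintegral_sub_right_eq_self]
  simp_rw [this]
  rw [lintegral_const_mul _ hP]

lemma mass_D (hP : Measurable P) : ∫⁻ x, ∫⁻ y, P (x + y) * P y = (∫⁻ x, P x) * ∫⁻ x, P x := by
  rw [lintegral_lintegral_swap (by fun_prop)]
  have : ∀ y, ∫⁻ x, P (x + y) * P y = (∫⁻ x, P x) * P y := by
    intro y
    rw [lintegral_mul_const _ (by fun_prop), lintegral_add_right_eq_self]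
  simp_rw [this]
  rw [lintegral_const_mul _ hP]

lemma energy (hP : Measurable P) :
    ∫⁻ x, (∫⁻ y, P (x - y) * P y) * (∫⁻ y, P (x - y) * P y)
      = ∫⁻ x, (∫⁻ y, P (x + y) * P y) * (∫⁻ y, P (x + y) * P y) := by
  have hD : Measurable fun x => ∫⁻ y, P (x + y) * P y :=
    Measurable.lintegral_prod_right' (f := fun z : (Fin n → ℝ) × (Fin n → ℝ) => P (z.1 + z.2) * P z.2) (by fun_prop)
  set D := fun x => ∫⁻ y, P (x + y) * P y with hDd
  have hS : Measurable fun x => ∫⁻ y, P (x - y) * P y :=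
    Measurable.lintegral_prod_right' (f := fun z : (Fin n → ℝ) × (Fin n → ℝ) => P (z.1 - z.2) * P z.2) (by fun_prop)
  set S := fun x => ∫⁻ y, P (x - y) * P y with hSd
  have s1 : ∀ x, S x * S x = ∫⁻ y, P (x - y) * P y * S x := by
    intro x
    rw [lintegral_mul_const _ (by fun_prop)]
  have s2 : ∀ y, ∫⁻ x, P (x - y) * P y * S x = ∫⁻ z, P y * P z * D (z - y) := by
    intro y
    have : ∀ x, P (x - y) * P y * S x = ∫⁻ z, P (x - y) * P y * (P (x - z) * P z) := by
      intro x
      rw [lintegral_const_mul _ (by fun_prop)]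
    simp_rw [this]
    rw [lintegral_lintegral_swap (by fun_prop)]
    congr 1
    funext z
    rw [hDd, ← lintegral_const_mul _ (by fun_prop),
      ← lintegral_add_right_eq_self _ z]
    congr 1
    funext w
    rw [show w + z - y = z - y + w by abel, show w + z - z = w by abel]
    ring
  calc ∫⁻ x, S x * S x = ∫⁻ x, ∫⁻ y, P (x - y) * P y * S x := by simp_rw [s1]
    _ = ∫⁻ y, ∫⁻ x, P (x - y) * P y * S x := lintegral_lintegral_swap (by fun_prop)
    _ = ∫⁻ y, ∫⁻ z, P y * P z * D (z - y) := by simp_rw [s2]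
    _ = ∫⁻ y, ∫⁻ u, P y * P (u + y) * D u := by
      congr 1
      funext y
      rw [← lintegral_add_right_eq_self _ y]
      simp
    _ = ∫⁻ u, ∫⁻ y, P y * P (u + y) * D u := lintegral_lintegral_swap (by fun_prop)
    _ = ∫⁻ u, D u * D u := by
      congr 1
      funext u
      rw [lintegral_mul_const _ (by fun_prop)]
      simp_rw [mul_comm (P _) (P (u + _))]
      rfl
end conv

lemma toReal_pack {n : ℕ} {F : (Fin n → ℝ) → ℝ≥0∞} (hF : LC F) (h1 : ∫⁻ x, F x = 1)
    (hl : Integrable fun x => (F x).toReal * Real.log (F x).toReal) :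
    (∫ x, (F x).toReal = 1) ∧
    (∀ x, 0 < (F x).toReal →
      Real.log (F x).toReal - n ≤ ∫ x, (F x).toReal * Real.log (F x).toReal) ∧
    (Integrable fun x => (F x).toReal * (F x).toReal) ∧
    0 < ∫ x, (F x).toReal * (F x).toReal ∧
    ∫ x, (F x).toReal * Real.log (F x).toReal ≤ Real.log (∫ x, (F x).toReal * (F x).toReal) ∧
    Real.log (∫ x, (F x).toReal * (F x).toReal) - n
      ≤ ∫ x, (F x).toReal * Real.log (F x).toReal := by
  have hm : AEMeasurable F := hF.aemeasurable volume
  have hnt : ∀ x, F x ≠ ∞ := hF.ne_top (by simp [h1]) (by simp [h1])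
  have hi : ∫ x, (F x).toReal = 1 := by
    rw [integral_toReal hm (Filter.Eventually.of_forall fun x => (hnt x).lt_top), h1]
    simp
  have hfi : Integrable fun x => (F x).toReal := integrable_toReal_of_lintegral_ne_top hm (by simp [h1])
  have hent := ent_lower (f := fun x => (F x).toReal) (fun x => ENNReal.toReal_nonneg) hi (by
    intro x y t h0 h1
    have := ENNReal.toReal_mono (hnt _) (hF x y t h0 h1)
    simpa [ENNReal.toReal_mul, ENNReal.toReal_rpow] using this) hl
  set I := ∫ x, (F x).toReal * Real.log (F x).toReal with hI
  have hb : ∀ x, (F x).toReal ≤ Real.exp (I + n) := by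
    intro x
    rcases (ENNReal.toReal_nonneg (a := F x)).eq_or_lt with h | h
    · rw [← h]; positivity
    · rw [← Real.log_le_iff_le_exp h]
      linarith [hent x h]
  have hsq : Integrable fun x => (F x).toReal * (F x).toReal := by
    refine hfi.mul_bdd (c := Real.exp (I + n)) hfi.aestronglyMeasurable ?_
    refine Filter.Eventually.of_forall fun x => ?_
    rw [Real.norm_of_nonneg ENNReal.toReal_nonneg]
    exact hb x
  obtain ⟨hp, hj⟩ := jensen (fun x => ENNReal.toReal_nonneg) hi hsq hl
  refine ⟨hi, hent, hsq, hp, hj, ?_⟩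
  have : ∫ x, (F x).toReal * (F x).toReal ≤ ∫ x, (F x).toReal * Real.exp (I + n) :=
    integral_mono hsq (hfi.mul_const _) fun x =>
      mul_le_mul_of_nonneg_left (hb x) ENNReal.toReal_nonneg
  rw [integral_mul_const, hi, one_mul, ← Real.log_le_iff_le_exp hp] at this
  linarith

end Helpers

open scoped ENNReal

/-- For i.i.d. random vectors `X, Y` in ℝⁿ with log-concave density `p`:
`h(X−Y) ≤ h(X) + n` and `h(X+Y) ≤ h(X) + 2n`. -/
theorem stmt_14 (n : ℕ) (p : (Fin n → ℝ) → ℝ)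
    (hnn : ∀ x, 0 ≤ p x) (hpdf : ∫ x, p x = 1)
    (hlc : ∀ x y : Fin n → ℝ, ∀ t : ℝ, 0 ≤ t → t ≤ 1 →
      p x ^ t * p y ^ (1 - t) ≤ p (t • x + (1 - t) • y))
    (s d : (Fin n → ℝ) → ℝ)
    (hs : s = fun x => ∫ y, p (x - y) * p y)
    (hd : d = fun x => ∫ y, p (x + y) * p y)
    (h1 : Integrable fun x => p x * Real.log (p x))
    (h2 : Integrable fun x => s x * Real.log (s x))
    (h3 : Integrable fun x => d x * Real.log (d x)) :
    (-∫ x, d x * Real.log (d x)) ≤ (-∫ x, p x * Real.log (p x)) + n ∧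
    (-∫ x, s x * Real.log (s x)) ≤ (-∫ x, p x * Real.log (p x)) + 2 * n := by
  have hpi : Integrable p := by
    by_contra h
    rw [integral_undef h] at hpdf
    exact zero_ne_one hpdf
  set P : (Fin n → ℝ) → ℝ≥0∞ := fun x => ENNReal.ofReal (p x) with hPdef
  have hPLC : LC P := by
    intro x y t t0 t1
    have t1' : 0 ≤ 1 - t := by linarith
    simp only [hPdef]
    rw [ENNReal.ofReal_rpow_of_nonneg (hnn x) t0.le, ENNReal.ofReal_rpow_of_nonneg (hnn y) t1',
      ← ENNReal.ofReal_mul (Real.rpow_nonneg (hnn x) _)]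
    exact ENNReal.ofReal_le_ofReal (hlc x y t t0.le t1.le)
  have hPm : AEMeasurable P := hpi.aestronglyMeasurable.aemeasurable.ennreal_ofReal
  have hP1 : ∫⁻ x, P x = 1 := by
    rw [← ofReal_integral_eq_lintegral_ofReal hpi (Filter.Eventually.of_forall hnn), hpdf]
    simp
  set D : (Fin n → ℝ) → ℝ≥0∞ := fun x => ∫⁻ y, P (x + y) * P y with hD
  set S : (Fin n → ℝ) → ℝ≥0∞ := fun x => ∫⁻ y, P (x - y) * P y with hS
  have hP2 : LC fun z : (Fin n → ℝ) × (Fin n → ℝ) => P z.2 :=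
    hPLC.comp _ (by intro a b t; simp)
  have hDLC : LC D := LC.marg_pi n (F := fun z => P (z.1 + z.2) * P z.2)
    (LC.mul (hPLC.comp (fun z : (Fin n → ℝ) × (Fin n → ℝ) => z.1 + z.2)
      (by intro a b t; simp only [Prod.fst_add, Prod.snd_add, Prod.smul_fst, Prod.smul_snd, smul_add]; abel)) hP2)
  have hSLC : LC S := LC.marg_pi n (F := fun z => P (z.1 - z.2) * P z.2)
    (LC.mul (hPLC.comp (fun z : (Fin n → ℝ) × (Fin n → ℝ) => z.1 - z.2)
      (by intro a b t; simp only [Prod.fst_add, Prod.snd_add, Prod.smul_fst, Prod.smul_snd, smul_sub]; abel)) hP2)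
  -- measurable modification
  set Q := hPm.mk P with hQ
  have hQm : Measurable Q := hPm.measurable_mk
  have hPQ : P =ᵐ[volume] Q := hPm.ae_eq_mk
  have hQ1 : ∫⁻ x, Q x = 1 := by rw [← lintegral_congr_ae hPQ, hP1]
  have hDQ : D = fun x => ∫⁻ y, Q (x + y) * Q y := by
    funext x
    apply lintegral_congr_ae
    have := (measurePreserving_add_left (volume : Measure (Fin n → ℝ)) x).quasiMeasurePreserving.ae_eq_comp hPQ
    filter_upwards [hPQ, this] with y e1 e2
    simp only [Function.comp] at e2
    rw [e1, e2]
  have hSQ : S = fun x => ∫⁻ y, Q (x - y) * Q y := by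
    funext x
    apply lintegral_congr_ae
    have := (Measure.measurePreserving_sub_left (volume : Measure (Fin n → ℝ)) x).quasiMeasurePreserving.ae_eq_comp hPQ
    filter_upwards [hPQ, this] with y e1 e2
    simp only [Function.comp] at e2
    rw [e1, e2]
  have hD1 : ∫⁻ x, D x = 1 := by rw [hDQ, mass_D Q hQm, hQ1, one_mul]
  have hS1 : ∫⁻ x, S x = 1 := by rw [hSQ, mass_S Q hQm, hQ1, one_mul]
  have hE : ∫⁻ x, S x * S x = ∫⁻ x, D x * D x := by rw [hSQ, hDQ]; exact energy Q hQm
  have hdD : d = fun x => (D x).toReal := by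
    rw [hd]
    funext x
    rw [integral_eq_lintegral_of_nonneg_ae
      (Filter.Eventually.of_forall fun y => mul_nonneg (hnn _) (hnn _))]
    · simp only [hD, hPdef]
      congr 1
      refine lintegral_congr fun y => ?_
      rw [ENNReal.ofReal_mul (hnn _)]
    · exact (hpi.comp_add_left x).aestronglyMeasurable.mul hpi.aestronglyMeasurable
  have hsS : s = fun x => (S x).toReal := by
    rw [hs]
    funext x
    rw [integral_eq_lintegral_of_nonneg_ae
      (Filter.Eventually.of_forall fun y => mul_nonneg (hnn _) (hnn _))]
    · simp only [hS, hPdef]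
      congr 1
      refine lintegral_congr fun y => ?_
      rw [ENNReal.ofReal_mul (hnn _)]
    · exact (hpi.comp_sub_left x).aestronglyMeasurable.mul hpi.aestronglyMeasurable
  have hDnt : ∀ x, D x ≠ ∞ := hDLC.ne_top (by simp [hD1]) (by simp [hD1])
  have hSnt : ∀ x, S x ≠ ∞ := hSLC.ne_top (by simp [hS1]) (by simp [hS1])
  have hd0 : (D 0).toReal = ∫ x, p x * p x := by
    have := congrFun hdD 0
    rw [hd] at this
    simpa using this.symm
  have hpp : Integrable fun x => p x * p x := by
    refine ⟨hpi.aestronglyMeasurable.mul hpi.aestronglyMeasurable, ?_⟩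
    rw [hasFiniteIntegral_iff_ofReal (Filter.Eventually.of_forall fun y => mul_self_nonneg _)]
    have := (hDnt 0).lt_top
    simp only [hD, hPdef, zero_add] at this
    simpa only [ENNReal.ofReal_mul (hnn _)] using this
  obtain ⟨hpos, hj⟩ := jensen hnn hpdf hpp h1
  rw [hdD] at h3 ⊢
  rw [hsS] at h2 ⊢
  obtain ⟨-, dE, -, -, dJ, -⟩ := toReal_pack hDLC hD1 h3
  obtain ⟨-, -, -, -, -, sL⟩ := toReal_pack hSLC hS1 h2
  have hEr : ∫ x, (S x).toReal * (S x).toReal = ∫ x, (D x).toReal * (D x).toReal := by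
    simp_rw [← ENNReal.toReal_mul]
    have mD : AEMeasurable D := hDLC.aemeasurable volume
    have mS : AEMeasurable S := hSLC.aemeasurable volume
    rw [integral_toReal (f := fun x => S x * S x) (mS.mul mS) (Filter.Eventually.of_forall fun x =>
        (ENNReal.mul_ne_top (hSnt x) (hSnt x)).lt_top),
      integral_toReal (f := fun x => D x * D x) (mD.mul mD) (Filter.Eventually.of_forall fun x =>
        (ENNReal.mul_ne_top (hDnt x) (hDnt x)).lt_top)]
    rw [hE]
  rw [hEr] at sL
  have d0 := dE 0 (by rw [hd0]; exact hpos)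
  rw [hd0] at d0
  simp only at d0 dJ sL ⊢
  constructor <;> linarith
end
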